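/- arXiv:2012.12216 — 2 statements merged into one kernel-verified Lean document; each statement's English description precedes it below -/
import Mathlib

section
/- Let K \subseteq \R^n be a centrally symmetric convex set and v a unit vector. Then Inf_v[K] = E_{x \sim N(0,1)^n}[-K(x) h_2(\langle x, v \rangle)] = 0 if and only if, outside a set of Gaussian measure zero, K(x) = K(y) whenever the projections of x and y onto the orthogonal complement of v coincide. -/
open MeasureTheory ProbabilityTheory

/-- The standard Gaussian measure `N(0,1)^n` on `ℝ^n`. -/
noncomputable def stdGaussian (n : ℕ) : Measure (Fin n → ℝ) :=
  Measure.pi fun _ => gaussianReal 0 1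

open scoped ENNReal

instance isProbabilityMeasure_stdGaussian_fin (n : ℕ) :
    IsProbabilityMeasure (_root_.stdGaussian n) := by
  unfold _root_.stdGaussian; infer_instance

lemma strongDual_apply_eq_sum {n : ℕ} (L : StrongDual ℝ (Fin n → ℝ)) (x : Fin n → ℝ) :
    L x = ∑ i, L (Pi.single i 1) * x i := by
  conv_lhs => rw [pi_eq_sum_univ' x, map_sum]
  simp [mul_comm]

lemma charFunDual_stdGaussian_fin (n : ℕ) (L : StrongDual ℝ (Fin n → ℝ)) :
    charFunDual (_root_.stdGaussian n) L =
      Complex.exp (-(∑ i, (L (Pi.single i 1)) ^ 2 : ℝ) / 2) := by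
  obtain ⟨l, hl⟩ : ∃ l : Fin n → ℝ, ∀ i, L (Pi.single i 1) = l i := ⟨_, fun _ => rfl⟩
  have hL (x : Fin n → ℝ) : L x = ∑ i, l i * x i := by
    simp_rw [← hl]
    exact strongDual_apply_eq_sum L x
  simp_rw [charFunDual_apply, _root_.stdGaussian, hl, hL, Complex.ofReal_sum, Finset.sum_mul,
    Complex.exp_sum]
  rw [integral_fintype_prod_eq_prod (μ := fun _ : Fin n => gaussianReal 0 1)
    (f := fun (i : Fin n) (x : ℝ) ↦ Complex.exp ((l i * x : ℝ) * Complex.I))]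
  simp_rw [Complex.ofReal_mul, ← charFun_apply_real, charFun_gaussianReal]
  rw [← Complex.exp_sum]
  simp [Finset.sum_div, neg_div]

lemma charFunDual_gaussianReal_zero_one (L : StrongDual ℝ ℝ) :
    charFunDual (gaussianReal 0 1) L = Complex.exp (-((L 1) ^ 2 : ℝ) / 2) := by
  obtain ⟨c, hc⟩ : ∃ c, L 1 = c := ⟨_, rfl⟩
  have hL (x : ℝ) : L x = c * x := by
    rw [← hc, ← mul_one x, ← smul_eq_mul, map_smul, smul_eq_mul, smul_eq_mul, mul_one, mul_comm]
  simp_rw [charFunDual_apply, hc, hL, Complex.ofReal_mul, ← charFun_apply_real,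
    charFun_gaussianReal]
  simp [neg_div]

/-- Replace the component of a vector along `v` by the given multiple of `v`. -/
noncomputable def resample {n : ℕ} (v : Fin n → ℝ) : (Fin n → ℝ) × ℝ →L[ℝ] (Fin n → ℝ) :=
  LinearMap.toContinuousLinearMap
  { toFun := fun p => p.1 - (∑ i, p.1 i * v i) • v + p.2 • v
    map_add' := fun p q => by
      simp only [Prod.fst_add, Prod.snd_add, Pi.add_apply, add_mul, Finset.sum_add_distrib,
        add_smul]
      abel
    map_smul' := fun c p => by
      ext j
      simp [Finset.mul_sum, Finset.sum_mul, mul_add, mul_sub, mul_assoc] }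

lemma resample_apply {n : ℕ} (v x : Fin n → ℝ) (s : ℝ) :
    resample v (x, s) = x - (∑ i, x i * v i) • v + s • v := rfl

lemma sum_resample_mul {n : ℕ} {v : Fin n → ℝ} (hv : ∑ i, (v i) ^ 2 = 1) (x : Fin n → ℝ) (s : ℝ) :
    ∑ i, resample v (x, s) i * v i = s := by
  simp only [resample_apply, Pi.add_apply, Pi.sub_apply, Pi.smul_apply, smul_eq_mul, add_mul,
    sub_mul, Finset.sum_add_distrib, Finset.sum_sub_distrib, mul_assoc, ← Finset.mul_sum,
    ← pow_two, hv]
  ring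

lemma map_resample_stdGaussian {n : ℕ} {v : Fin n → ℝ} (hv : ∑ i, (v i) ^ 2 = 1) :
    ((_root_.stdGaussian n).prod (gaussianReal 0 1)).map (resample v) = _root_.stdGaussian n := by
  apply Measure.ext_of_charFunDual
  ext L
  rw [charFunDual_map, charFunDual_prod, charFunDual_stdGaussian_fin, charFunDual_stdGaussian_fin,
    charFunDual_gaussianReal_zero_one, ← Complex.exp_add, ← add_div, ← neg_add,
    ← Complex.ofReal_add]
  congr 4
  have hinl (i : Fin n) : ((L ∘SL resample v) ∘SL ContinuousLinearMap.inl ℝ (Fin n → ℝ) ℝ)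
      (Pi.single i 1) = L (Pi.single i 1) - v i * L v := by
    simp [resample_apply, Pi.single_apply]
  have hinr : ((L ∘SL resample v) ∘SL ContinuousLinearMap.inr ℝ (Fin n → ℝ) ℝ) 1 = L v := by
    simp [resample_apply]
  simp_rw [hinl, hinr, sub_sq, mul_pow, Finset.sum_add_distrib, Finset.sum_sub_distrib]
  rw [← Finset.sum_mul, hv]
  have : ∑ i, 2 * L (Pi.single i 1) * (v i * L v) = 2 * L v * L v := by
    nth_rewrite 2 [strongDual_apply_eq_sum L v]
    rw [Finset.mul_sum, Finset.sum_mul]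
    exact Finset.sum_congr rfl fun i _ => by ring
  rw [this]
  ring

lemma volume_add_volume_le_of_isCompact {A B C : Set ℝ} (hA : IsCompact A) (hB : IsCompact B)
    (hA' : A.Nonempty) (hB' : B.Nonempty) (hC : ∀ x ∈ A, ∀ y ∈ B, x + y ∈ C) :
    volume A + volume B ≤ volume C := by
  obtain ⟨p, hp, hpA⟩ := hA.exists_isGreatest hA'
  obtain ⟨q, hq, hqB⟩ := hB.exists_isLeast hB'
  have hU : volume ((fun x => x + q) '' A) = volume A := by simp
  have hV : volume ((fun x => p + x) '' B) = volume B := by simp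
  rw [← hU, ← hV, ← measure_union₀]
  · apply measure_mono
    rintro _ (⟨x, hx, rfl⟩ | ⟨y, hy, rfl⟩)
    · exact hC x hx q hq
    · exact hC p hp y hy
  · exact (hB.image (by fun_prop)).measurableSet.nullMeasurableSet
  · refine measure_mono_null (t := {p + q}) ?_ (by simp)
    rintro _ ⟨⟨x, hx, rfl⟩, ⟨y, hy, hxy⟩⟩
    have h1 := hpA hx
    have h2 := hqB hy
    simp only [Set.mem_singleton_iff] at *
    linarith

/-- The one-dimensional Brunn-Minkowski inequality. -/
lemma volume_combo_le {A B C : Set ℝ} (hA : MeasurableSet A) (hB : MeasurableSet B)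
    (hA' : A.Nonempty) (hB' : B.Nonempty) {a b : ℝ} (ha : 0 < a) (hb : 0 < b)
    (hC : ∀ x ∈ A, ∀ y ∈ B, a * x + b * y ∈ C) :
    ENNReal.ofReal a * volume A + ENNReal.ofReal b * volume B ≤ volume C := by
  obtain ⟨p, hp⟩ := hA'
  obtain ⟨q, hq⟩ := hB'
  have key (s : Set ℝ) (hs : s ⊆ A) (hsc : IsCompact s) (t : Set ℝ) (ht : t ⊆ B)
      (htc : IsCompact t) :
      ENNReal.ofReal a * volume s + ENNReal.ofReal b * volume t ≤ volume C := by
    have hscale (c : ℝ) (hc : 0 < c) (u : Set ℝ) :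
        ENNReal.ofReal c * volume u = volume ((fun x => c * x) '' u) := by
      have := Measure.addHaar_smul (volume : Measure ℝ) c u
      simp only [Module.finrank_self, pow_one, abs_of_pos hc] at this
      rw [← this]
      rfl
    calc ENNReal.ofReal a * volume s + ENNReal.ofReal b * volume t
        ≤ ENNReal.ofReal a * volume (insert p s) + ENNReal.ofReal b * volume (insert q t) := by
          gcongr <;> exact Set.subset_insert _ _
      _ ≤ volume C := by
          rw [hscale a ha, hscale b hb]
          refine volume_add_volume_le_of_isCompact ((hsc.insert p).image (by fun_prop))
            ((htc.insert q).image (by fun_prop)) ((Set.insert_nonempty _ _).image _)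
            ((Set.insert_nonempty _ _).image _) ?_
          rintro _ ⟨x, hx, rfl⟩ _ ⟨y, hy, rfl⟩
          exact hC x (Set.insert_subset hp hs hx) y (Set.insert_subset hq ht hy)
  rw [hA.measure_eq_iSup_isCompact, hB.measure_eq_iSup_isCompact]
  simp only [iSup_and', iSup_subtype', ENNReal.mul_iSup]
  have : Nonempty {s : Set ℝ // s ⊆ A ∧ IsCompact s} := ⟨∅, by simp⟩
  have : Nonempty {s : Set ℝ // s ⊆ B ∧ IsCompact s} := ⟨∅, by simp⟩
  exact ENNReal.iSup_add_iSup_le fun s t => key s s.2.1 s.2.2 t t.2.1 t.2.2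

lemma lintegral_eq_lintegral_volume_lt {f : ℝ → ℝ≥0∞} (hf : Measurable f) (hf1 : ∀ x, f x ≤ 1) :
    ∫⁻ x, f x = ∫⁻ t in Set.Ioi (0 : ℝ), volume {x | ENNReal.ofReal t < f x} := by
  have hfin (x : ℝ) : f x ≠ ∞ := ((hf1 x).trans_lt ENNReal.one_lt_top).ne
  have := lintegral_eq_lintegral_meas_lt (volume : Measure ℝ) (f := fun x => (f x).toReal)
    (Filter.Eventually.of_forall fun x => ENNReal.toReal_nonneg) hf.ennreal_toReal.aemeasurable
  simp_rw [ENNReal.ofReal_toReal (hfin _)] at this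
  rw [this]
  refine setLIntegral_congr_fun measurableSet_Ioi fun t ht => ?_
  simp_rw [ENNReal.ofReal_lt_iff_lt_toReal (le_of_lt ht) (hfin _)]

lemma ENNReal.rpow_mul_rpow_le_combo {a b : ℝ} (ha : 0 < a) (hb : 0 < b) (hab : a + b = 1)
    (x y : ℝ≥0∞) : x ^ a * y ^ b ≤ ENNReal.ofReal a * x + ENNReal.ofReal b * y := by
  rcases eq_or_ne x ∞ with rfl | hx
  · simp [ENNReal.mul_top, ha]
  rcases eq_or_ne y ∞ with rfl | hy
  · simp [ENNReal.mul_top, hb]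
  have := Real.geom_mean_le_arith_mean2_weighted ha.le hb.le
    (ENNReal.toReal_nonneg (a := x)) (ENNReal.toReal_nonneg (a := y)) hab
  have h2 := ENNReal.ofReal_le_ofReal this
  rw [ENNReal.ofReal_mul (by positivity), ENNReal.ofReal_add (by positivity) (by positivity),
    ENNReal.ofReal_mul ha.le, ENNReal.ofReal_mul hb.le,
    ← ENNReal.ofReal_rpow_of_nonneg (by positivity) ha.le,
    ← ENNReal.ofReal_rpow_of_nonneg (by positivity) hb.le,
    ENNReal.ofReal_toReal hx, ENNReal.ofReal_toReal hy] at h2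
  exact h2

lemma lintegral_combo_le_of_sup_eq_one {a b : ℝ} (ha : 0 < a) (hb : 0 < b) (hab : a + b = 1)
    {f g h : ℝ → ℝ≥0∞} (hf : Measurable f) (hg : Measurable g) (hh : Measurable h)
    (hf1 : ⨆ x, f x = 1) (hg1 : ⨆ x, g x = 1)
    (hfgh : ∀ x y, f x ^ a * g y ^ b ≤ h (a * x + b * y)) :
    ENNReal.ofReal a * (∫⁻ x, f x) + ENNReal.ofReal b * (∫⁻ x, g x) ≤ ∫⁻ x, h x := by
  have hfle (x : ℝ) : f x ≤ 1 := hf1 ▸ le_iSup f x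
  have hgle (x : ℝ) : g x ≤ 1 := hg1 ▸ le_iSup g x
  calc ENNReal.ofReal a * (∫⁻ x, f x) + ENNReal.ofReal b * (∫⁻ x, g x)
      ≤ ∫⁻ x, min (h x) 1 := by
        rw [lintegral_eq_lintegral_volume_lt hf hfle, lintegral_eq_lintegral_volume_lt hg hgle,
          lintegral_eq_lintegral_volume_lt (hh.min measurable_const) fun x => min_le_right _ _]
        refine (add_le_add (lintegral_const_mul_le _ _) (lintegral_const_mul_le _ _)).trans
          ((le_lintegral_add _ _).trans ?_)
        refine setLIntegral_mono' measurableSet_Ioi fun t ht => ?_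
        rcases lt_or_ge t 1 with ht1 | ht1
        · have ht1' : ENNReal.ofReal t < 1 := by simpa using ht1
          refine volume_combo_le (measurableSet_lt measurable_const hf)
            (measurableSet_lt measurable_const hg) ?_ ?_ ha hb ?_
          · exact lt_iSup_iff.1 (hf1 ▸ ht1')
          · exact lt_iSup_iff.1 (hg1 ▸ ht1')
          · intro x hx y hy
            refine lt_min (lt_of_lt_of_le ?_ (hfgh x y)) ht1'
            calc ENNReal.ofReal t = ENNReal.ofReal t ^ a * ENNReal.ofReal t ^ b := by
                  rw [← ENNReal.rpow_add _ _ (by simpa using ht) (by simp), hab, ENNReal.rpow_one]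
              _ < f x ^ a * g y ^ b :=
                  ENNReal.mul_lt_mul (ENNReal.rpow_lt_rpow hx ha) (ENNReal.rpow_lt_rpow hy hb)
        · have hempty {k : ℝ → ℝ≥0∞} (hk : ∀ x, k x ≤ 1) : {x | ENNReal.ofReal t < k x} = ∅ := by
            refine Set.eq_empty_of_forall_notMem fun x hx => ?_
            exact absurd (lt_of_lt_of_le hx (hk x)) (by simpa using ht1)
          simp [hempty hfle, hempty hgle]
    _ ≤ ∫⁻ x, h x := lintegral_mono fun x => min_le_left _ _

/-- A measure `μ` satisfies the Prékopa-Leindler inequality with weights `a` and `b`,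
for functions bounded by one. -/
def IsPrekopaLeindler {E : Type*} [AddCommGroup E] [Module ℝ E] [MeasurableSpace E] (a b : ℝ)
    (μ : Measure E) : Prop :=
  ∀ f g h : E → ℝ≥0∞, Measurable f → Measurable g → Measurable h → (∀ x, f x ≤ 1) →
    (∀ x, g x ≤ 1) → (∀ x y, f x ^ a * g y ^ b ≤ h (a • x + b • y)) →
    (∫⁻ x, f x ∂μ) ^ a * (∫⁻ x, g x ∂μ) ^ b ≤ ∫⁻ x, h x ∂μ

lemma isPrekopaLeindler_volume {a b : ℝ} (ha : 0 < a) (hb : 0 < b) (hab : a + b = 1) :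
    IsPrekopaLeindler a b (volume : Measure ℝ) := by
  intro f g h hf hg hh hf1 hg1 hfgh
  set A := ⨆ x, f x with hA
  set B := ⨆ x, g x with hB
  have hAtop : A ≠ ∞ := ((iSup_le hf1).trans_lt ENNReal.one_lt_top).ne
  have hBtop : B ≠ ∞ := ((iSup_le hg1).trans_lt ENNReal.one_lt_top).ne
  rcases eq_or_ne A 0 with hA0 | hA0
  · have : ∀ x, f x = 0 := by simpa [hA] using hA0
    simp [this, ha]
  rcases eq_or_ne B 0 with hB0 | hB0
  · have : ∀ x, g x = 0 := by simpa [hB] using hB0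
    simp [this, hb]
  set c := A⁻¹ ^ a * B⁻¹ ^ b with hc
  have hA1 : A⁻¹ ≠ 0 := ENNReal.inv_ne_zero.2 hAtop
  have hA2 : A⁻¹ ≠ ∞ := ENNReal.inv_ne_top.2 hA0
  have hB1 : B⁻¹ ≠ 0 := ENNReal.inv_ne_zero.2 hBtop
  have hB2 : B⁻¹ ≠ ∞ := ENNReal.inv_ne_top.2 hB0
  have hc0 : c ≠ 0 := by
    exact mul_ne_zero (ENNReal.rpow_pos (pos_iff_ne_zero.2 hA1) hA2).ne'
      (ENNReal.rpow_pos (pos_iff_ne_zero.2 hB1) hB2).ne'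
  have hctop : c ≠ ∞ := ENNReal.mul_ne_top (ENNReal.rpow_ne_top_of_nonneg ha.le hA2)
    (ENNReal.rpow_ne_top_of_nonneg hb.le hB2)
  have hmul (x y : ℝ≥0∞) : (x * A⁻¹) ^ a * (y * B⁻¹) ^ b = x ^ a * y ^ b * c := by
    rw [ENNReal.mul_rpow_of_nonneg _ _ ha.le, ENNReal.mul_rpow_of_nonneg _ _ hb.le, hc]
    ring
  have key := (ENNReal.rpow_mul_rpow_le_combo ha hb hab _ _).trans
    (lintegral_combo_le_of_sup_eq_one ha hb hab (hf.mul_const A⁻¹) (hg.mul_const B⁻¹)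
    (hh.mul_const c) (by rw [← ENNReal.iSup_mul, ENNReal.mul_inv_cancel hA0 hAtop])
    (by rw [← ENNReal.iSup_mul, ENNReal.mul_inv_cancel hB0 hBtop])
    (fun x y => by rw [hmul]; gcongr; exact hfgh x y))
  rw [lintegral_mul_const _ hf, lintegral_mul_const _ hg, lintegral_mul_const _ hh, hmul] at key
  exact (ENNReal.mul_le_mul_iff_left hc0 hctop).1 key

lemma gaussianPDF_zero_one_le_one (x : ℝ) : gaussianPDF 0 1 x ≤ 1 := by
  rw [gaussianPDF, ENNReal.ofReal_le_one, gaussianPDFReal]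
  refine mul_le_one₀ (inv_le_one_of_one_le₀ ?_) (Real.exp_pos _).le ?_
  · rw [Real.one_le_sqrt]
    simp only [NNReal.coe_one]
    linarith [Real.pi_gt_three]
  · rw [Real.exp_le_one_iff]
    simp only [NNReal.coe_one]
    nlinarith [sq_nonneg (x - 0)]

lemma gaussianPDF_rpow_mul_rpow_le {a b : ℝ} (ha : 0 < a) (hb : 0 < b) (hab : a + b = 1)
    (x y : ℝ) : gaussianPDF 0 1 x ^ a * gaussianPDF 0 1 y ^ b ≤ gaussianPDF 0 1 (a * x + b * y) := by
  simp only [gaussianPDF]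
  rw [ENNReal.ofReal_rpow_of_nonneg (gaussianPDFReal_nonneg _ _ _) ha.le,
    ENNReal.ofReal_rpow_of_nonneg (gaussianPDFReal_nonneg _ _ _) hb.le,
    ← ENNReal.ofReal_mul (Real.rpow_nonneg (gaussianPDFReal_nonneg _ _ _) _)]
  apply ENNReal.ofReal_le_ofReal
  simp only [gaussianPDFReal, NNReal.coe_one, mul_one, sub_zero]
  have hc : 0 < (√(2 * Real.pi))⁻¹ := by positivity
  generalize (√(2 * Real.pi))⁻¹ = c at hc
  rw [Real.mul_rpow hc.le (Real.exp_pos _).le, Real.mul_rpow hc.le (Real.exp_pos _).le,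
    mul_mul_mul_comm, ← Real.rpow_add hc, hab, Real.rpow_one, ← Real.exp_mul, ← Real.exp_mul,
    ← Real.exp_add]
  gcongr
  have : (a * x + b * y) ^ 2 + a * b * (x - y) ^ 2 = (a + b) * (a * x ^ 2 + b * y ^ 2) := by ring
  rw [hab] at this
  nlinarith [mul_nonneg (mul_nonneg ha.le hb.le) (sq_nonneg (x - y))]

lemma isPrekopaLeindler_gaussianReal {a b : ℝ} (ha : 0 < a) (hb : 0 < b) (hab : a + b = 1) :
    IsPrekopaLeindler a b (gaussianReal 0 1) := by
  intro f g h hf hg hh hf1 hg1 hfgh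
  have hm : Measurable (gaussianPDF 0 1) := measurable_gaussianPDF 0 1
  rw [gaussianReal_of_var_ne_zero 0 one_ne_zero, lintegral_withDensity_eq_lintegral_mul _ hm hf,
    lintegral_withDensity_eq_lintegral_mul _ hm hg, lintegral_withDensity_eq_lintegral_mul _ hm hh]
  refine isPrekopaLeindler_volume ha hb hab _ _ _ (hm.mul hf) (hm.mul hg) (hm.mul hh)
    (fun x => mul_le_one' (gaussianPDF_zero_one_le_one x) (hf1 x))
    (fun x => mul_le_one' (gaussianPDF_zero_one_le_one x) (hg1 x)) fun x y => ?_
  simp only [Pi.mul_apply]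
  rw [ENNReal.mul_rpow_of_nonneg _ _ ha.le, ENNReal.mul_rpow_of_nonneg _ _ hb.le,
    mul_mul_mul_comm]
  exact mul_le_mul' (gaussianPDF_rpow_mul_rpow_le ha hb hab x y) (hfgh x y)

lemma IsPrekopaLeindler.prod {E F : Type*} [AddCommGroup E] [Module ℝ E] [MeasurableSpace E]
    [AddCommGroup F] [Module ℝ F] [MeasurableSpace F] {a b : ℝ} {μ : Measure E} {ν : Measure F}
    [IsProbabilityMeasure ν] (hμ : IsPrekopaLeindler a b μ)
    (hν : IsPrekopaLeindler a b ν) : IsPrekopaLeindler a b (μ.prod ν) := by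
  intro f g h hf hg hh hf1 hg1 hfgh
  rw [lintegral_prod _ hf.aemeasurable, lintegral_prod _ hg.aemeasurable,
    lintegral_prod _ hh.aemeasurable]
  have hle {k : E × F → ℝ≥0∞} (hk : ∀ x, k x ≤ 1) (x : E) : ∫⁻ y, k (x, y) ∂ν ≤ 1 :=
    (lintegral_mono fun y => hk (x, y)).trans (by simp)
  refine hμ _ _ _ hf.lintegral_prod_right' hg.lintegral_prod_right' hh.lintegral_prod_right'
    (hle hf1) (hle hg1) fun x y => ?_
  exact hν _ _ _ (hf.comp measurable_prodMk_left) (hg.comp measurable_prodMk_left)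
    (hh.comp measurable_prodMk_left) (fun _ => hf1 _) (fun _ => hg1 _)
    fun z w => hfgh (x, z) (y, w)

lemma isPrekopaLeindler_stdGaussian {a b : ℝ} (ha : 0 < a) (hb : 0 < b) (hab : a + b = 1) (n : ℕ) :
    IsPrekopaLeindler a b (_root_.stdGaussian n) := by
  induction n with
  | zero =>
    intro f g h hf hg hh hf1 hg1 hfgh
    rw [_root_.stdGaussian, Measure.pi_of_empty, lintegral_dirac' _ hf, lintegral_dirac' _ hg,
      lintegral_dirac' _ hh]
    convert hfgh _ _ using 2
  | succ n ih =>
    have hmp := (measurePreserving_piFinSuccAbove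
      (fun _ : Fin (n + 1) => gaussianReal 0 1) 0).symm
    intro f g h hf hg hh hf1 hg1 hfgh
    rw [_root_.stdGaussian, ← hmp.lintegral_comp hf, ← hmp.lintegral_comp hg,
      ← hmp.lintegral_comp hh]
    refine ((isPrekopaLeindler_gaussianReal ha hb hab).prod ih) _ _ _
      (hf.comp hmp.measurable) (hg.comp hmp.measurable) (hh.comp hmp.measurable)
      (fun _ => hf1 _) (fun _ => hg1 _) fun x y => ?_
    convert hfgh _ _ using 2
    ext i
    refine Fin.cases ?_ (fun j => ?_) i <;>
    simp [MeasurableEquiv.piFinSuccAbove, Fin.insertNthEquiv]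

lemma stdGaussian_absolutelyContinuous_volume (n : ℕ) : _root_.stdGaussian n ≪ volume := by
  induction n with
  | zero =>
    rw [_root_.stdGaussian, volume_pi, Measure.pi_of_empty, Measure.pi_of_empty]
  | succ n ih =>
    have h1 := (measurePreserving_piFinSuccAbove (fun _ : Fin (n + 1) => gaussianReal 0 1) 0).symm
    have h2 := (measurePreserving_piFinSuccAbove
      (fun _ : Fin (n + 1) => (volume : Measure ℝ)) 0).symm
    rw [_root_.stdGaussian, volume_pi, ← h1.map_eq, ← h2.map_eq]
    exact ((gaussianReal_absolutelyContinuous 0 one_ne_zero).prod ih).map h1.measurable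

lemma map_neg_stdGaussian (n : ℕ) :
    (_root_.stdGaussian n).map (fun x => -x) = _root_.stdGaussian n := by
  apply Measure.ext_of_charFunDual
  ext L
  have := charFunDual_map (μ := _root_.stdGaussian n) (-ContinuousLinearMap.id ℝ (Fin n → ℝ)) L
  have hneg : ⇑(-ContinuousLinearMap.id ℝ (Fin n → ℝ)) = fun x => -x := by ext; simp
  rw [hneg] at this
  rw [this, charFunDual_stdGaussian_fin, charFunDual_stdGaussian_fin]
  simp

/-- The cylinder over the slice of `C` at height `s` in direction `v`. -/
def sliceCylinder {n : ℕ} (v : Fin n → ℝ) (C : Set (Fin n → ℝ)) (s : ℝ) : Set (Fin n → ℝ) :=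
  {x | resample v (x, s) ∈ C}

lemma measurableSet_sliceCylinder {n : ℕ} (v : Fin n → ℝ) {C : Set (Fin n → ℝ)}
    (hC : IsClosed C) (s : ℝ) : MeasurableSet (sliceCylinder v C s) :=
  (hC.preimage (f := fun x => resample v (x, s)) (by fun_prop)).measurableSet

lemma stdGaussian_sliceCylinder_neg {n : ℕ} (v : Fin n → ℝ) {C : Set (Fin n → ℝ)}
    (hC : IsClosed C) (hsym : ∀ x ∈ C, -x ∈ C) (s : ℝ) :
    _root_.stdGaussian n (sliceCylinder v C (-s)) = _root_.stdGaussian n (sliceCylinder v C s) := by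
  nth_rewrite 1 [← map_neg_stdGaussian n]
  rw [Measure.map_apply measurable_neg (measurableSet_sliceCylinder v hC _)]
  congr 1
  ext x
  have : resample v (-x, -s) = -resample v (x, s) := by rw [← map_neg]; rfl
  simp only [sliceCylinder, Set.mem_preimage, Set.mem_ofPred_eq, this]
  exact ⟨fun h => by simpa using hsym _ h, fun h => hsym _ h⟩

lemma stdGaussian_sliceCylinder_anti {n : ℕ} (v : Fin n → ℝ) {C : Set (Fin n → ℝ)}
    (hC : IsClosed C) (hconv : Convex ℝ C) (hsym : ∀ x ∈ C, -x ∈ C) {r s : ℝ} (hrs : |r| ≤ s) :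
    _root_.stdGaussian n (sliceCylinder v C s) ≤ _root_.stdGaussian n (sliceCylinder v C r) := by
  obtain ⟨h1, h2⟩ := abs_le.1 hrs
  rcases h1.eq_or_lt with rfl | h1
  · rw [stdGaussian_sliceCylinder_neg v hC hsym]
  rcases h2.eq_or_lt with rfl | h2
  · rfl
  have hs : 0 < s := by linarith
  set a := (1 + r / s) / 2 with ha_def
  set b := (1 - r / s) / 2 with hb_def
  have hlt : r / s < 1 := (div_lt_one hs).2 h2
  have hgt : -1 < r / s := by rw [lt_div_iff₀ hs]; linarith
  have ha : 0 < a := by linarith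
  have hb : 0 < b := by linarith
  have hab : a + b = 1 := by rw [ha_def, hb_def]; ring
  have hr : r = a * s + b * (-s) := by rw [ha_def, hb_def]; field_simp; ring
  have hm := measurableSet_sliceCylinder v hC
  have hone (t : ℝ) (x : Fin n → ℝ) :
      (sliceCylinder v C t).indicator (1 : (Fin n → ℝ) → ℝ≥0∞) x ≤ 1 :=
    Set.indicator_le_self' (by simp) x
  have key := isPrekopaLeindler_stdGaussian ha hb hab n
    ((sliceCylinder v C s).indicator 1) ((sliceCylinder v C (-s)).indicator 1)
    ((sliceCylinder v C r).indicator 1) (measurable_one.indicator (hm _))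
    (measurable_one.indicator (hm _)) (measurable_one.indicator (hm _)) (hone _) (hone _) ?_
  · rw [lintegral_indicator_one (hm _), lintegral_indicator_one (hm _),
      lintegral_indicator_one (hm _), stdGaussian_sliceCylinder_neg v hC hsym,
      ← ENNReal.rpow_add_of_nonneg _ _ ha.le hb.le, hab, ENNReal.rpow_one] at key
    exact key
  · intro x y
    by_cases hx : x ∈ sliceCylinder v C s
    · by_cases hy : y ∈ sliceCylinder v C (-s)
      · have hxy : a • x + b • y ∈ sliceCylinder v C r := by
          have heq : resample v (a • x + b • y, r) =
              a • resample v (x, s) + b • resample v (y, -s) := by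
            rw [← map_smul, ← map_smul, ← map_add]
            congr 1
            ext1
            · rfl
            · simpa using hr
          rw [sliceCylinder, Set.mem_ofPred_eq, heq]
          exact hconv hx hy ha.le hb.le hab
        simp [hx, hy, hxy]
      · simp [hy, hb]
    · simp [hx, ha]

lemma integrable_sq_sub_one_gaussianReal :
    Integrable (fun s : ℝ => s ^ 2 - 1) (gaussianReal 0 1) :=
  (memLp_id_gaussianReal 2).integrable_sq.sub (integrable_const 1)

lemma integral_sq_sub_one_gaussianReal : ∫ s, (s ^ 2 - 1) ∂gaussianReal 0 1 = 0 := by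
  have h := variance_fun_id_gaussianReal (μ := 0) (v := 1)
  rw [variance_eq_integral measurable_id'.aemeasurable] at h
  simp only [integral_id_gaussianReal, sub_zero, NNReal.coe_one] at h
  have hsq : Integrable (fun s : ℝ => s ^ 2) (gaussianReal 0 1) :=
    (memLp_id_gaussianReal 2).integrable_sq
  rw [integral_sub hsq (integrable_const 1), h]
  simp

lemma integrable_indicator_resample {n : ℕ} (v : Fin n → ℝ) {C : Set (Fin n → ℝ)}
    (hC : IsClosed C) :
    Integrable (fun p : (Fin n → ℝ) × ℝ =>
      C.indicator (fun _ => (1 : ℝ)) (resample v p) * (p.2 ^ 2 - 1))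
      ((_root_.stdGaussian n).prod (gaussianReal 0 1)) := by
  have h := (integrable_sq_sub_one_gaussianReal.comp_snd (_root_.stdGaussian n)).indicator
    (hC.preimage (resample v).continuous).measurableSet
  refine h.congr (Filter.Eventually.of_forall fun p => ?_)
  by_cases hp : resample v p ∈ C <;> simp [hp]

lemma integral_indicator_eq_integral_prod {n : ℕ} {v : Fin n → ℝ} (hv : ∑ i, (v i) ^ 2 = 1)
    {C : Set (Fin n → ℝ)} (hC : IsClosed C) :
    ∫ x, C.indicator (fun _ => (1 : ℝ)) x * ((∑ i, x i * v i) ^ 2 - 1) ∂_root_.stdGaussian n =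
      ∫ p, C.indicator (fun _ => (1 : ℝ)) (resample v p) * (p.2 ^ 2 - 1)
        ∂(_root_.stdGaussian n).prod (gaussianReal 0 1) := by
  nth_rewrite 1 [← map_resample_stdGaussian hv]
  rw [integral_map (resample v).continuous.aemeasurable]
  · refine integral_congr_ae (Filter.Eventually.of_forall fun p => ?_)
    simp only [sum_resample_mul hv p.1 p.2]
  · refine Measurable.aestronglyMeasurable ?_
    exact (measurable_const.indicator hC.measurableSet).mul (by fun_prop)

lemma integral_indicator_resample {n : ℕ} (v : Fin n → ℝ) {C : Set (Fin n → ℝ)}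
    (hC : IsClosed C) (s : ℝ) :
    ∫ x, C.indicator (fun _ => (1 : ℝ)) (resample v (x, s)) * (s ^ 2 - 1) ∂_root_.stdGaussian n =
      (_root_.stdGaussian n).real (sliceCylinder v C s) * (s ^ 2 - 1) := by
  rw [integral_mul_const, ← integral_indicator_one (measurableSet_sliceCylinder v hC s)]
  rfl

lemma integral_indicator_eq_integral_slice {n : ℕ} {v : Fin n → ℝ} (hv : ∑ i, (v i) ^ 2 = 1)
    {C : Set (Fin n → ℝ)} (hC : IsClosed C) :
    ∫ x, C.indicator (fun _ => (1 : ℝ)) x * ((∑ i, x i * v i) ^ 2 - 1) ∂_root_.stdGaussian n =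
      ∫ s, (_root_.stdGaussian n).real (sliceCylinder v C s) * (s ^ 2 - 1) ∂gaussianReal 0 1 := by
  rw [integral_indicator_eq_integral_prod hv hC,
    integral_prod_symm _ (integrable_indicator_resample v hC)]
  exact integral_congr_ae (Filter.Eventually.of_forall (integral_indicator_resample v hC))

lemma stdGaussian_sliceCylinder_one_le {n : ℕ} {v : Fin n → ℝ} (hv : ∑ i, (v i) ^ 2 = 1)
    {C : Set (Fin n → ℝ)} (hC : IsClosed C) (hconv : Convex ℝ C) (hsym : ∀ x ∈ C, -x ∈ C)
    (h0 : ∫ x, C.indicator (fun _ => (1 : ℝ)) x * ((∑ i, x i * v i) ^ 2 - 1)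
      ∂_root_.stdGaussian n = 0) :
    (∀ᵐ s ∂gaussianReal 0 1, (_root_.stdGaussian n).real (sliceCylinder v C s) =
      (_root_.stdGaussian n).real (sliceCylinder v C 1)) ∧
    ∀ s, (_root_.stdGaussian n).real (sliceCylinder v C 1) ≤
      (_root_.stdGaussian n).real (sliceCylinder v C s) := by
  set G : ℝ → ℝ := fun s => (_root_.stdGaussian n).real (sliceCylinder v C s) with hG
  have hanti {r s : ℝ} (hrs : |r| ≤ s) : G s ≤ G r :=
    ENNReal.toReal_mono (measure_ne_top _ _) (stdGaussian_sliceCylinder_anti v hC hconv hsym hrs)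
  have hint : Integrable (fun s => G s * (s ^ 2 - 1)) (gaussianReal 0 1) := by
    have := (integrable_indicator_resample v hC).integral_prod_right
    exact this.congr (Filter.Eventually.of_forall (integral_indicator_resample v hC))
  have hint1 := integrable_sq_sub_one_gaussianReal.const_mul (G 1)
  rw [integral_indicator_eq_integral_slice hv hC] at h0
  have hnonneg : 0 ≤ fun s => G 1 * (s ^ 2 - 1) - G s * (s ^ 2 - 1) := by
    intro s
    simp only [Pi.zero_apply]
    rcases le_total |s| 1 with hs | hs
    · nlinarith [hanti hs, (sq_le_one_iff_abs_le_one s).2 hs]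
    · have h1 : G s ≤ G 1 := by
        have h2 : G |s| = G s := by
          rcases abs_choice s with h | h
          · rw [h]
          · rw [h]
            simp only [hG, Measure.real, stdGaussian_sliceCylinder_neg v hC hsym]
        rw [← h2]
        exact hanti (by simpa using hs)
      nlinarith [(one_le_sq_iff_one_le_abs s).2 hs]
  have hzero : ∫ s, (G 1 * (s ^ 2 - 1) - G s * (s ^ 2 - 1)) ∂gaussianReal 0 1 = 0 := by
    rw [integral_sub hint1 hint, integral_const_mul, integral_sq_sub_one_gaussianReal]
    simpa using h0
  have hae := (integral_eq_zero_iff_of_nonneg hnonneg (hint1.sub hint)).1 hzero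
  have := nullSingletonClass_gaussianReal (μ := 0) (v := 1) one_ne_zero
  have hconst : ∀ᵐ s ∂gaussianReal 0 1, G s = G 1 := by
    have hne : ∀ᵐ s ∂gaussianReal 0 1, s ∉ ({1, -1} : Set ℝ) :=
      measure_eq_zero_iff_ae_notMem.1 ((Set.toFinite _).measure_zero _)
    filter_upwards [hae, hne] with s hs hs1
    simp only [Pi.zero_apply, ← sub_mul, mul_eq_zero, sub_eq_zero] at hs
    rcases hs with hs | hs
    · exact hs.symm
    · exact absurd (by simpa using hs) hs1
  refine ⟨hconst, fun s => ?_⟩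
  have hdense : Dense {s | G s = G 1} := Measure.dense_of_ae (μ := (volume : Measure ℝ))
    ((gaussianReal_absolutelyContinuous' 0 one_ne_zero).ae_le hconst)
  obtain ⟨S, hS, hS'⟩ := hdense.exists_mem_open isOpen_Ioi (Set.nonempty_Ioi (a := |s|))
  exact hS.symm.le.trans (hanti (le_of_lt hS'))

lemma add_smul_mem_of_slices_bounded_below {n : ℕ} (v : Fin n → ℝ) {C : Set (Fin n → ℝ)}
    (hC : IsClosed C) (hconv : Convex ℝ C) {c : ℝ} (hc : 0 < c)
    (hle : ∀ s, c ≤ (_root_.stdGaussian n).real (sliceCylinder v C s)) {y : Fin n → ℝ}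
    (hy : y ∈ C) (τ : ℝ) : y + τ • v ∈ C := by
  obtain ⟨R, hR⟩ : ∃ R : ℕ, 1 - c < (_root_.stdGaussian n).real (Metric.closedBall 0 (R : ℝ)) := by
    have hmono : Monotone fun R : ℕ => Metric.closedBall (0 : Fin n → ℝ) (R : ℝ) :=
      fun i j hij => Metric.closedBall_subset_closedBall (by exact_mod_cast hij)
    have := tendsto_measure_iUnion_atTop (μ := _root_.stdGaussian n) hmono
    rw [Metric.iUnion_closedBall_nat, measure_univ] at this
    have := (ENNReal.tendsto_toReal ENNReal.one_ne_top).comp this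
    exact (this.eventually (lt_mem_nhds (by simpa using hc))).exists
  have hex (s : ℝ) : ∃ x : Fin n → ℝ, ‖x‖ ≤ R ∧ resample v (x, s) ∈ C := by
    by_contra! hcon
    have hdisj : Disjoint (Metric.closedBall (0 : Fin n → ℝ) (R : ℝ)) (sliceCylinder v C s) :=
      Set.disjoint_left.2 fun x hx => hcon x (by simpa using hx)
    have h1 := measureReal_union (μ := _root_.stdGaussian n) hdisj
      (measurableSet_sliceCylinder v hC s)
    have h2 := measureReal_le_one (μ := _root_.stdGaussian n)
      (s := Metric.closedBall (0 : Fin n → ℝ) (R : ℝ) ∪ sliceCylinder v C s)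
    linarith [hle s]
  choose X hX hXC using hex
  set ε : ℕ → ℝ := fun k => 1 / ((k : ℝ) + 1) with hε
  have hε0 : Filter.Tendsto ε Filter.atTop (nhds 0) := tendsto_one_div_add_atTop_nhds_zero_nat
  set Z : ℕ → (Fin n → ℝ) := fun k => resample v (X (τ * (k + 1)), 0) with hZ
  have hZb : Filter.Tendsto (fun k => ε k • Z k) Filter.atTop (nhds 0) := by
    refine hε0.zero_smul_isBoundedUnder_le ⟨‖resample v‖ * R, ?_⟩
    simp only [Filter.eventually_map]
    refine Filter.Eventually.of_forall fun k => ((resample v).le_opNorm _).trans ?_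
    gcongr
    simpa [Prod.norm_def] using hX _
  have hlim : Filter.Tendsto (fun k => (1 - ε k) • y + (ε k • Z k + τ • v)) Filter.atTop
      (nhds (y + τ • v)) := by
    simpa using ((hε0.const_sub 1).smul_const y).add (hZb.add_const (τ • v))
  refine hC.mem_of_tendsto hlim (Filter.Eventually.of_forall fun k => ?_)
  have hk : (0 : ℝ) < k + 1 := by positivity
  have hsplit : ε k • Z k + τ • v = ε k • resample v (X (τ * (k + 1)), τ * (k + 1)) := by
    simp only [hZ, resample_apply, zero_smul, add_zero, smul_add, smul_smul]
    congr 2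
    simp only [hε]
    field_simp
  rw [hsplit]
  have hε1 : ε k ≤ 1 := by
    rw [hε, div_le_one hk]
    linarith [Nat.cast_nonneg (α := ℝ) k]
  exact hconv hy (hXC _) (by linarith) (by positivity) (by ring)

lemma stdGaussian_eq_zero_of_slices_ae_zero {n : ℕ} {v : Fin n → ℝ} (hv : ∑ i, (v i) ^ 2 = 1)
    {C : Set (Fin n → ℝ)} (hC : IsClosed C)
    (h : ∀ᵐ s ∂gaussianReal 0 1, (_root_.stdGaussian n).real (sliceCylinder v C s) = 0) :
    _root_.stdGaussian n C = 0 := by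
  rw [← map_resample_stdGaussian hv, Measure.map_apply (resample v).continuous.measurable
    hC.measurableSet, Measure.prod_apply_symm (hC.preimage (resample v).continuous).measurableSet,
    lintegral_eq_zero_iff' (by
      exact (measurable_measure_prodMk_right
        (hC.preimage (resample v).continuous).measurableSet).aemeasurable)]
  filter_upwards [h] with s hs
  exact (measureReal_eq_zero_iff).1 hs

lemma integral_indicator_eq_zero_of_invariant {n : ℕ} {v : Fin n → ℝ}
    (hv : ∑ i, (v i) ^ 2 = 1) {C : Set (Fin n → ℝ)} (hC : IsClosed C) {N : Set (Fin n → ℝ)}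
    (hN : _root_.stdGaussian n N = 0)
    (hinv : ∀ x y : Fin n → ℝ, x ∉ N → y ∉ N →
      x - (∑ i, x i * v i) • v = y - (∑ i, y i * v i) • v → (x ∈ C ↔ y ∈ C)) :
    ∫ x, C.indicator (fun _ => (1 : ℝ)) x * ((∑ i, x i * v i) ^ 2 - 1)
      ∂_root_.stdGaussian n = 0 := by
  rw [integral_indicator_eq_integral_prod hv hC,
    integral_prod _ (integrable_indicator_resample v hC)]
  have hae : ∀ᵐ p ∂(_root_.stdGaussian n).prod (gaussianReal 0 1), resample v p ∉ N := by
    apply ae_of_ae_map (p := fun x => x ∉ N) (resample v).continuous.aemeasurable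
    rw [map_resample_stdGaussian hv]
    exact measure_eq_zero_iff_ae_notMem.1 hN
  refine integral_eq_zero_of_ae ?_
  filter_upwards [Measure.ae_ae_of_ae_prod hae] with x hx
  obtain ⟨s₀, hs₀⟩ := hx.exists
  have hcongr : ∫ s, C.indicator (fun _ => (1 : ℝ)) (resample v (x, s)) * (s ^ 2 - 1)
      ∂gaussianReal 0 1 = ∫ s, C.indicator (fun _ => (1 : ℝ)) (resample v (x, s₀)) * (s ^ 2 - 1)
      ∂gaussianReal 0 1 := by
    refine integral_congr_ae ?_
    filter_upwards [hx] with s hs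
    have hiff := hinv _ _ hs hs₀ (by
      rw [sum_resample_mul hv, sum_resample_mul hv, resample_apply, resample_apply]
      abel)
    by_cases hmem : resample v (x, s₀) ∈ C
    · simp [hmem, hiff.2 hmem]
    · simp [hmem, mt hiff.1 hmem]
  simp only [Pi.zero_apply]
  rw [hcongr, integral_const_mul, integral_sq_sub_one_gaussianReal, mul_zero]

/-- Characterization of zero influence: for a centrally symmetric convex set `K` and a
unit vector `v`, `Inf_v[K] = 0` iff, outside a Gaussian-null set, membership in `K`
depends only on the projection orthogonal to `v`. -/
theorem stmt11 (n : ℕ) (K : Set (Fin n → ℝ)) (hconv : Convex ℝ K)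
    (hsym : ∀ x ∈ K, -x ∈ K) (v : Fin n → ℝ) (hv : ∑ i, (v i) ^ 2 = 1) :
    (∫ x, (-(K.indicator (fun _ => (1:ℝ)) x)) *
        (((∑ i, x i * v i) ^ 2 - 1) / Real.sqrt 2) ∂(stdGaussian n)) = 0 ↔
      ∃ N : Set (Fin n → ℝ), stdGaussian n N = 0 ∧
        ∀ x y : Fin n → ℝ, x ∉ N → y ∉ N →
          x - (∑ i, x i * v i) • v = y - (∑ i, y i * v i) • v → (x ∈ K ↔ y ∈ K) := by
  have hnull : _root_.stdGaussian n (closure K \ K) = 0 :=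
    measure_mono_null (Set.sdiff_subset_sdiff_right interior_subset)
      (stdGaussian_absolutelyContinuous_volume n (hconv.addHaar_frontier volume))
  have hmem {x : Fin n → ℝ} (hx : x ∉ closure K \ K) : x ∈ K ↔ x ∈ closure K :=
    ⟨fun h => subset_closure h, fun h => by_contra fun h' => hx ⟨h, h'⟩⟩
  have hC : IsClosed (closure K) := isClosed_closure
  have hCconv := hconv.closure
  have hCsym : ∀ x ∈ closure K, -x ∈ closure K := fun x hx =>
    map_mem_closure continuous_neg hx hsym
  have hint : (∫ x, (-(K.indicator (fun _ => (1:ℝ)) x)) *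
      (((∑ i, x i * v i) ^ 2 - 1) / Real.sqrt 2) ∂(_root_.stdGaussian n)) =
      (-(1 / Real.sqrt 2)) * ∫ x, (closure K).indicator (fun _ => (1 : ℝ)) x *
        ((∑ i, x i * v i) ^ 2 - 1) ∂_root_.stdGaussian n := by
    rw [← integral_const_mul]
    refine integral_congr_ae ?_
    filter_upwards [measure_eq_zero_iff_ae_notMem.1 hnull] with x hx
    have : K.indicator (fun _ => (1:ℝ)) x = (closure K).indicator (fun _ => (1 : ℝ)) x := by
      by_cases h : x ∈ K
      · simp [h, (hmem hx).1 h]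
      · simp [h, mt (hmem hx).2 h]
    rw [this]
    ring
  rw [hint, mul_eq_zero, or_iff_right (by simp)]
  constructor
  · intro h0
    obtain ⟨hae, hle⟩ := stdGaussian_sliceCylinder_one_le hv hC hCconv hCsym h0
    rcases (measureReal_nonneg (μ := _root_.stdGaussian n)
      (s := sliceCylinder v (closure K) 1)).eq_or_lt with hc | hc
    · rw [← hc] at hae
      refine ⟨closure K, stdGaussian_eq_zero_of_slices_ae_zero hv hC hae, fun x y hx hy _ => ?_⟩
      exact iff_of_false (fun h => hx (subset_closure h)) (fun h => hy (subset_closure h))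
    · have htrans {x y : Fin n → ℝ}
          (hxy : x - (∑ i, x i * v i) • v = y - (∑ i, y i * v i) • v) (hx : x ∈ closure K) :
          y ∈ closure K := by
        have := add_smul_mem_of_slices_bounded_below v hC hCconv hc hle hx
          (∑ i, y i * v i - ∑ i, x i * v i)
        rwa [sub_smul, ← add_sub_assoc, add_sub_right_comm, hxy, sub_add_cancel] at this
      refine ⟨_, hnull, fun x y hx hy hxy => ?_⟩
      rw [hmem hx, hmem hy]
      exact ⟨htrans hxy, htrans hxy.symm⟩
  · rintro ⟨N, hN, hinv⟩
    refine integral_indicator_eq_zero_of_invariant hv hC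
      (measure_union_null hN hnull) fun x y hx hy hxy => ?_
    simp only [Set.mem_union, not_or] at hx hy
    rw [← hmem hx.2, ← hmem hy.2]
    exact hinv x y hx.1 hy.1 hxy
end

section
/- Let K, L \subseteq \R^n be centrally symmetric convex sets, identified with their 0/1 indicator functions. Then E[KL] - E[K]E[L] \ge (1/C) \cdot \Phi(\sum_{|\alpha|=2} \tilde{K}(\alpha)\tilde{L}(\alpha)), where expectations and Hermite coefficients are with respect to the standard Gaussian measure on \R^n, \Phi(x) = \min\{x, x/\log^2(1/x)\}, and C > 0 is a universal constant. (This may be proven assuming Royen's Gaussian Correlation Inequality in the form that \rho \mapsto \langle U_\rho K, L \rangle is nondecreasing on [0,1].) -/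
open MeasureTheory ProbabilityTheory

/-- The normalized probabilists' Hermite polynomial `h_j(x) = He_j(x)/√(j!)`. -/
noncomputable def hermiteFn (j : ℕ) (x : ℝ) : ℝ :=
  ((Polynomial.hermite j).map (Int.castRingHom ℝ)).eval x / Real.sqrt (Nat.factorial j)

/-- `Φ(x) = min{x, x / log²(1/x)}`. -/
noncomputable def Phi (x : ℝ) : ℝ := min x (x / (Real.log (1 / x)) ^ 2)

/-- The Ornstein-Uhlenbeck noise operator `U_ρ f(x) = E_g[f(ρx + √(1-ρ²)g)]`. -/
noncomputable def ouOp (n : ℕ) (ρ : ℝ) (f : (Fin n → ℝ) → ℝ) (x : Fin n → ℝ) : ℝ :=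
  ∫ y, f (ρ • x + Real.sqrt (1 - ρ ^ 2) • y) ∂(stdGaussian n)


open Polynomial in
/-- Markov brothers' inequality at the endpoint `1`. -/
lemma abs_derivative_eval_one_le {d : ℕ} {P : ℝ[X]} {M : ℝ} (hM : 0 < M) (hdeg : P.degree ≤ d)
    (hP : ∀ x ∈ Set.Icc (-1 : ℝ) 1, |P.eval x| ≤ M) :
    |P.derivative.eval 1| ≤ d ^ 2 * M := by
  have key : ∀ c : ℝ, |c| ≤ M⁻¹ → c * P.derivative.eval 1 ≤ d ^ 2 := by
    intro c hc
    have h := Chebyshev.eval_iterate_derivative_le_of_forall_abs_le_one (n := d) (P := c • P)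
      (k := 1) (x := 1) le_rfl ((degree_smul_le c P).trans hdeg) (fun x hx => by
        rw [eval_smul, smul_eq_mul, abs_mul, ← inv_mul_cancel₀ hM.ne']
        exact mul_le_mul hc (hP x hx) (abs_nonneg _) (inv_nonneg.2 hM.le))
    simpa [Chebyshev.T_derivative_eq_U, Chebyshev.U_eval_one, sq] using h
  have hinv : |M⁻¹| ≤ M⁻¹ := (abs_of_pos (inv_pos.2 hM)).le
  have h₁ := key M⁻¹ hinv
  have h₂ := key (-M⁻¹) (by rwa [abs_neg])
  rw [inv_mul_le_iff₀ hM] at h₁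
  rw [neg_mul, ← mul_neg, inv_mul_le_iff₀ hM] at h₂
  exact abs_le.2 ⟨by linarith, by linarith⟩

open Polynomial in
/-- A power series with absolutely summable coefficients that stays within `M` of a constant on
`[0, 1/2]` has a small linear coefficient. -/
lemma abs_coeff_one_le_of_forall_abs_tsum_sub_le {b : ℕ → ℝ} {S M p₀ : ℝ} (hS : 0 < S)
    (hb : Summable fun j => |b j|) (hbS : ∑' j, |b j| ≤ S)
    (h : ∀ t ∈ Set.Icc (0 : ℝ) (1 / 2), |∑' j, b j * t ^ j - p₀| ≤ M) {d : ℕ} (hd : 1 ≤ d) :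
    |b 1| ≤ 4 * d ^ 2 * (M + S * (1 / 2) ^ d) := by
  have hM : 0 ≤ M := (abs_nonneg _).trans (h 0 (by norm_num))
  set Q : ℝ[X] := ∑ j ∈ Finset.range (d + 1), C (b j) * X ^ j - C p₀ with hQ
  set P : ℝ[X] := Q.comp (C (1 / 4) * (1 - X)) with hP
  have hQdeg : Q.natDegree ≤ d := by
    refine (natDegree_sub_le _ _).trans (max_le ?_ ((natDegree_C p₀).le.trans d.zero_le))
    refine natDegree_sum_le_of_forall_le _ _ fun j hj => ?_
    exact (natDegree_C_mul_X_pow_le _ _).trans (by simpa [Nat.lt_succ_iff] using hj)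
  have hPdeg : P.degree ≤ d := by
    refine natDegree_le_iff_degree_le.1 (natDegree_comp_le.trans ?_)
    have : (C (1 / 4 : ℝ) * (1 - X)).natDegree ≤ 1 := by compute_degree
    calc _ ≤ d * 1 := Nat.mul_le_mul hQdeg this
      _ = d := mul_one d
  have hbound : ∀ x ∈ Set.Icc (-1 : ℝ) 1, |P.eval x| ≤ M + S * (1 / 2) ^ d := by
    intro x hx
    set t : ℝ := 1 / 4 * (1 - x) with ht
    have ht0 : 0 ≤ t := by linarith [hx.2]
    have ht1 : t ≤ 1 / 2 := by linarith [hx.1]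
    have hle : ∀ j, |b j * t ^ j| ≤ |b j| := fun j => by
      rw [abs_mul, abs_of_nonneg (pow_nonneg ht0 j)]
      exact mul_le_of_le_one_right (abs_nonneg _) (pow_le_one₀ ht0 (by linarith))
    have hsum : Summable fun j => b j * t ^ j :=
      (Summable.of_nonneg_of_le (fun _ => abs_nonneg _) hle hb).of_abs
    have hsplit := hsum.sum_add_tsum_nat_add (d + 1)
    have htail : |∑' j, b (j + (d + 1)) * t ^ (j + (d + 1))| ≤ S * (1 / 2) ^ d := by
      have hb' := (summable_nat_add_iff (d + 1)).2 hb
      have hle' : ∀ j, |b (j + (d + 1)) * t ^ (j + (d + 1))| ≤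
          |b (j + (d + 1))| * (1 / 2) ^ d := fun j => by
        rw [abs_mul, abs_of_nonneg (pow_nonneg ht0 _)]
        refine mul_le_mul_of_nonneg_left ?_ (abs_nonneg _)
        calc t ^ (j + (d + 1)) ≤ (1 / 2) ^ (j + (d + 1)) := pow_le_pow_left₀ ht0 ht1 _
          _ ≤ (1 / 2) ^ d := pow_le_pow_of_le_one (by norm_num) (by norm_num) (by omega)
      have h₁ := tsum_of_norm_bounded (hb'.mul_right ((1 / 2 : ℝ) ^ d)).hasSum
        fun j => (Real.norm_eq_abs _).le.trans (hle' j)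
      rw [tsum_mul_right, Real.norm_eq_abs] at h₁
      refine h₁.trans (mul_le_mul_of_nonneg_right (le_trans ?_ hbS) (by positivity))
      rw [← hb.sum_add_tsum_nat_add (d + 1)]
      exact le_add_of_nonneg_left (Finset.sum_nonneg fun _ _ => abs_nonneg _)
    have heval : P.eval x = (∑' j, b j * t ^ j - p₀) -
        ∑' j, b (j + (d + 1)) * t ^ (j + (d + 1)) := by
      rw [← hsplit]
      simp [hP, hQ, eval_finsetSum, ht]
      ring
    rw [heval]
    exact (abs_sub _ _).trans (add_le_add (h t ⟨ht0, ht1⟩) htail)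
  have hder : P.derivative.eval 1 = -(b 1) / 4 := by
    have hQ' : Q.derivative.eval 0 = b 1 := by
      rw [← coeff_zero_eq_eval_zero, coeff_derivative, hQ]
      simp [coeff_X_pow]
      omega
    rw [hP, derivative_comp, eval_mul, eval_comp]
    simp [hQ']
    ring
  have := abs_derivative_eval_one_le (by positivity) hPdeg hbound
  rw [hder, abs_div, abs_neg, abs_of_pos (by norm_num : (0 : ℝ) < 4)] at this
  linarith

/-- If `a ≤ 4 d² (δ + 2 · 2⁻ᵈ)` for every `d ≥ 1`, then `δ` dominates `Φ(a)`. -/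
lemma Phi_le_of_forall_le {a δ : ℝ} (hδ : 0 ≤ δ)
    (h : ∀ d : ℕ, 1 ≤ d → a ≤ 4 * d ^ 2 * (δ + 2 * (1 / 2) ^ d)) : Phi a ≤ 12800 * δ := by
  rcases le_or_gt a 0 with ha | ha
  · exact (min_le_left _ _).trans (ha.trans (by positivity))
  set m : ℝ := max 1 (Real.log (1 / a)) with hm
  have hm1 : 1 ≤ m := le_max_left _ _
  set k : ℕ := ⌈m⌉₊ with hk
  have hmk : m ≤ k := Nat.le_ceil m
  have hk1 : 1 ≤ k := by exact_mod_cast hm1.trans hmk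
  have hk2 : (k : ℝ) ≤ 2 * m := by
    have := (Nat.ceil_lt_add_one (by linarith : 0 ≤ m)).le
    linarith
  have hak : (1 / 4 : ℝ) ^ k ≤ a := by
    have h₁ : Real.exp (-k) ≤ a := by
      rw [← Real.exp_log ha, Real.exp_le_exp]
      have := (le_max_right 1 (Real.log (1 / a))).trans hmk
      rw [one_div, Real.log_inv] at this
      linarith
    refine le_trans ?_ h₁
    rw [show (-(k : ℝ)) = k * (-1) by ring, Real.exp_nat_mul]
    refine pow_le_pow_left₀ (by norm_num) ?_ k
    rw [Real.exp_neg, one_div]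
    exact inv_anti₀ (Real.exp_pos 1) (by linarith [Real.exp_one_lt_d9])
  have hsmall : 8 * ((20 * k : ℕ) : ℝ) ^ 2 * (1 / 2) ^ (20 * k) ≤ a / 2 := by
    have h4 : (k : ℝ) ^ 2 ≤ 4 ^ k := by
      have : (k : ℝ) ≤ 2 ^ k := by exact_mod_cast Nat.lt_two_pow_self.le
      calc (k : ℝ) ^ 2 ≤ (2 ^ k) ^ 2 := pow_le_pow_left₀ (by positivity) this 2
        _ = 4 ^ k := by rw [← pow_mul, mul_comm, pow_mul]; norm_num
    have h16 : (6400 : ℝ) ≤ 65536 ^ k :=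
      (by norm_num : (6400 : ℝ) ≤ 65536 ^ 1).trans (pow_le_pow_right₀ (by norm_num) hk1)
    have hpow : (1 / 2 : ℝ) ^ (20 * k) = (1 / 4) ^ k * ((1 / 4) ^ k * (1 / 65536) ^ k) := by
      rw [pow_mul, ← mul_pow, ← mul_pow]; norm_num
    have : 6400 * (k : ℝ) ^ 2 * ((1 / 4) ^ k * (1 / 65536) ^ k) ≤ 1 := by
      calc 6400 * (k : ℝ) ^ 2 * ((1 / 4) ^ k * (1 / 65536) ^ k)
          ≤ 65536 ^ k * 4 ^ k * ((1 / 4) ^ k * (1 / 65536) ^ k) := by gcongr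
        _ = 1 := by rw [← mul_pow, ← mul_pow, ← mul_pow]; norm_num
    rw [hpow]
    push_cast
    nlinarith [pow_pos (by norm_num : (0 : ℝ) < 1 / 4) k]
  have hmain := h (20 * k) (by omega)
  have hbd : a ≤ 12800 * m ^ 2 * δ := by
    have : (k : ℝ) ^ 2 ≤ 4 * m ^ 2 := by nlinarith
    have := mul_le_mul_of_nonneg_right this hδ
    push_cast at hmain hsmall
    nlinarith
  rcases le_total (Real.log (1 / a)) 1 with hl | hl
  · rw [max_eq_left hl] at hm
    rw [hm] at hbd
    exact (min_le_left _ _).trans (by linarith)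
  · rw [max_eq_right hl] at hm
    refine (min_le_right _ _).trans ?_
    rw [← hm, div_le_iff₀ (by positivity)]
    linarith

section GaussianSpace

instance (n : ℕ) : IsProbabilityMeasure (_root_.stdGaussian n) := by
  unfold _root_.stdGaussian; infer_instance

variable {n : ℕ}

open Matrix in
lemma exp_dotProduct_eq_prod (s x : Fin n → ℝ) :
    Real.exp (s ⬝ᵥ x) = ∏ i, Real.exp (s i * x i) := by
  rw [dotProduct, Real.exp_sum]

open Matrix in
lemma integrable_exp_dotProduct (s : Fin n → ℝ) :
    Integrable (fun x => Real.exp (s ⬝ᵥ x)) (_root_.stdGaussian n) := by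
  simp_rw [exp_dotProduct_eq_prod]
  exact Integrable.fintype_prod (f := fun i y => Real.exp (s i * y))
    fun i => integrable_exp_mul_gaussianReal (s i)

open Matrix in
lemma integral_exp_dotProduct (s : Fin n → ℝ) :
    ∫ x, Real.exp (s ⬝ᵥ x) ∂(_root_.stdGaussian n) = Real.exp (s ⬝ᵥ s / 2) := by
  simp_rw [exp_dotProduct_eq_prod]
  rw [_root_.stdGaussian, integral_fintype_prod_eq_prod (fun i y => Real.exp (s i * y)), dotProduct,
    Finset.sum_div, Real.exp_sum]
  refine Finset.prod_congr rfl fun i _ => ?_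
  have := congrFun (mgf_fun_id_gaussianReal (μ := 0) (v := 1)) (s i)
  simpa [mgf, sq] using this

open Matrix in
/-- Finite measures on `ℝⁿ` with equal, everywhere finite moment generating functions agree. -/
lemma measure_ext_of_integral_exp_dotProduct {μ ν : Measure (Fin n → ℝ)} [IsFiniteMeasure μ]
    [IsFiniteMeasure ν] (hμ : ∀ s, Integrable (fun x => Real.exp (s ⬝ᵥ x)) μ)
    (h : ∀ s, ∫ x, Real.exp (s ⬝ᵥ x) ∂μ = ∫ x, Real.exp (s ⬝ᵥ x) ∂ν) : μ = ν := by
  refine Measure.ext_of_charFunDual (funext fun L => ?_)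
  set X : (Fin n → ℝ) → ℝ := fun x => L x with hX
  obtain ⟨s, hs⟩ : ∃ s : Fin n → ℝ, ∀ x, L x = s ⬝ᵥ x := by
    refine ⟨fun i => L (Pi.single i 1), fun x => ?_⟩
    conv_lhs => rw [← LinearMap.sum_single_apply _ x]
    simp only [map_sum, dotProduct]
    refine Finset.sum_congr rfl fun i _ => ?_
    rw [show Pi.single i (x i) = x i • (Pi.single i 1 : Fin n → ℝ) by
      rw [← Pi.single_smul, smul_eq_mul, mul_one], map_smul, smul_eq_mul, mul_comm]
  have hexp : ∀ t : ℝ, (fun x => Real.exp (t * X x)) = fun x => Real.exp ((t • s) ⬝ᵥ x) := by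
    intro t; ext x; rw [hX]; simp only [hs, smul_dotProduct, smul_eq_mul]
  have hset : integrableExpSet X μ = Set.univ := by
    ext t; simpa [integrableExpSet, hexp t] using hμ (t • s)
  have hmgf : mgf X μ = mgf X ν := by
    ext t; rw [mgf, mgf, hexp t, h]
  have hzero : μ = 0 ↔ ν = 0 := by
    have h0 := h 0
    simp only [zero_dotProduct, Real.exp_zero, integral_const, smul_eq_mul, mul_one] at h0
    rw [← Measure.measure_univ_eq_zero, ← Measure.measure_univ_eq_zero (μ := ν),
      ← measureReal_eq_zero_iff, ← measureReal_eq_zero_iff, h0]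
  have key := eqOn_complexMGF_of_mgf' hmgf hzero (x := Complex.I) (by simp [hset])
  simp only [complexMGF] at key
  simp only [charFunDual_apply]
  simpa [mul_comm] using key

open Matrix in
lemma stdGaussian_absolutelyContinuous : _root_.stdGaussian n ≪ volume := by
  set p : (Fin n → ℝ) → ℝ := fun x => ∏ i, gaussianPDFReal 0 1 (x i) with hp
  have hp0 : ∀ x, 0 ≤ p x := fun x => Finset.prod_nonneg fun i _ => gaussianPDFReal_nonneg _ _ _
  have hpi : Integrable p volume :=
    Integrable.fintype_prod (f := fun _ y => gaussianPDFReal 0 1 y)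
      fun i => integrable_gaussianPDFReal 0 1
  have hpm : Measurable p := by
    refine Finset.measurable_prod _ fun i _ => ?_
    exact (measurable_gaussianPDFReal 0 1).comp (measurable_pi_apply i)
  have hfin : IsFiniteMeasure (volume.withDensity fun x => ENNReal.ofReal (p x)) :=
    isFiniteMeasure_withDensity_ofReal hpi.2
  have hprod : ∀ s x : Fin n → ℝ, p x * Real.exp (s ⬝ᵥ x) =
      ∏ i, (gaussianPDFReal 0 1 (x i) * Real.exp (s i * x i)) := fun s x => by
    rw [exp_dotProduct_eq_prod, hp, Finset.prod_mul_distrib]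
  have heq : _root_.stdGaussian n = volume.withDensity fun x => ENNReal.ofReal (p x) := by
    refine measure_ext_of_integral_exp_dotProduct integrable_exp_dotProduct fun s => ?_
    rw [integral_withDensity_eq_integral_toReal_smul₀ (by fun_prop) (by simp)]
    simp only [ENNReal.toReal_ofReal (hp0 _), smul_eq_mul, hprod]
    simp only [exp_dotProduct_eq_prod]
    rw [_root_.stdGaussian, integral_fintype_prod_eq_prod (fun i y => Real.exp (s i * y)),
      integral_fintype_prod_volume_eq_prod
        (fun i y => gaussianPDFReal 0 1 y * Real.exp (s i * y))]
    refine Finset.prod_congr rfl fun i _ => ?_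
    rw [integral_gaussianReal_eq_integral_smul one_ne_zero]
    simp only [smul_eq_mul]
  rw [heq]
  exact withDensity_absolutelyContinuous _ _

/-- The map `(x, y) ↦ ρ x + √(1 - ρ²) y` underlying the Ornstein-Uhlenbeck operator. -/
noncomputable def ouMap (n : ℕ) (ρ : ℝ) (z : (Fin n → ℝ) × (Fin n → ℝ)) : Fin n → ℝ :=
  ρ • z.1 + Real.sqrt (1 - ρ ^ 2) • z.2

lemma measurable_ouMap (ρ : ℝ) : Measurable (ouMap n ρ) := by
  unfold ouMap; fun_prop

open Matrix in
lemma exp_dotProduct_ouMap (ρ : ℝ) (s : Fin n → ℝ) (z : (Fin n → ℝ) × (Fin n → ℝ)) :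
    Real.exp (s ⬝ᵥ ouMap n ρ z) =
      Real.exp ((ρ • s) ⬝ᵥ z.1) * Real.exp ((Real.sqrt (1 - ρ ^ 2) • s) ⬝ᵥ z.2) := by
  rw [ouMap, dotProduct_add, Real.exp_add, dotProduct_smul, dotProduct_smul, smul_dotProduct,
    smul_dotProduct]

open Matrix in
lemma measurePreserving_ouMap {ρ : ℝ} (hρ : ρ ^ 2 ≤ 1) :
    MeasurePreserving (ouMap n ρ) ((_root_.stdGaussian n).prod (_root_.stdGaussian n))
      (_root_.stdGaussian n) := by
  have hm := measurable_ouMap (n := n) ρ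
  refine ⟨hm, ?_⟩
  have := Measure.isProbabilityMeasure_map
    (μ := (_root_.stdGaussian n).prod (_root_.stdGaussian n)) hm.aemeasurable
  have hcont : ∀ s : Fin n → ℝ, Continuous fun x => Real.exp (s ⬝ᵥ x) := fun s =>
    Real.continuous_exp.comp (continuous_const.dotProduct continuous_id)
  refine measure_ext_of_integral_exp_dotProduct (fun s => ?_) fun s => ?_
  · rw [integrable_map_measure (hcont s).aestronglyMeasurable hm.aemeasurable]
    simp only [Function.comp_def, exp_dotProduct_ouMap]
    exact (integrable_exp_dotProduct _).mul_prod (integrable_exp_dotProduct _)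
  · rw [integral_map hm.aemeasurable (hcont s).aestronglyMeasurable]
    simp only [exp_dotProduct_ouMap]
    rw [integral_prod_mul (fun x => Real.exp ((ρ • s) ⬝ᵥ x))
      (fun y => Real.exp ((Real.sqrt (1 - ρ ^ 2) • s) ⬝ᵥ y))]
    simp only [integral_exp_dotProduct, ← Real.exp_add]
    simp only [smul_dotProduct, dotProduct_smul, smul_eq_mul]
    congr 1
    have := Real.mul_self_sqrt (by linarith : 0 ≤ 1 - ρ ^ 2)
    linear_combination (s ⬝ᵥ s / 2) * this

lemma measurePreserving_neg_stdGaussian :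
    MeasurePreserving (fun x : Fin n → ℝ => -x) (_root_.stdGaussian n) (_root_.stdGaussian n) := by
  have h : MeasurePreserving (fun y : ℝ => -y) (gaussianReal 0 1) (gaussianReal 0 1) :=
    ⟨measurable_neg, by rw [gaussianReal_map_neg, neg_zero]⟩
  exact measurePreserving_pi _ _ fun _ => h

open Matrix in
/-- The normalized exponential `x ↦ exp(⟨s, x⟩ - |s|² / 2)`, the generating function of the Hermite
polynomials. -/
noncomputable def gaussExp (s x : Fin n → ℝ) : ℝ := Real.exp (s ⬝ᵥ x - s ⬝ᵥ s / 2)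

open Matrix in
lemma gaussExp_eq_mul (s x : Fin n → ℝ) :
    gaussExp s x = Real.exp (-(s ⬝ᵥ s / 2)) * Real.exp (s ⬝ᵥ x) := by
  rw [gaussExp, ← Real.exp_add]; ring_nf

open Matrix in
lemma continuous_gaussExp (s : Fin n → ℝ) : Continuous (gaussExp s) :=
  Real.continuous_exp.comp
    ((continuous_const.dotProduct continuous_id).sub continuous_const)

open Matrix in
lemma memLp_gaussExp (s : Fin n → ℝ) : MemLp (gaussExp s) 2 (_root_.stdGaussian n) := by
  rw [memLp_two_iff_integrable_sq (continuous_gaussExp s).aestronglyMeasurable]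
  have : (fun x => gaussExp s x ^ 2) =
      fun x => Real.exp (-(s ⬝ᵥ s)) * Real.exp (((2 : ℝ) • s) ⬝ᵥ x) := by
    ext x
    rw [gaussExp, ← Real.exp_nat_mul, ← Real.exp_add, smul_dotProduct, smul_eq_mul]
    congr 1
    push_cast
    ring
  rw [this]
  exact (integrable_exp_dotProduct _).const_mul _

/-- `gaussExp s` as an element of `L²`. -/
noncomputable def gaussExpLp (s : Fin n → ℝ) : Lp ℝ 2 (_root_.stdGaussian n) :=
  (memLp_gaussExp s).toLp (gaussExp s)

lemma inner_toLp_toLp {α : Type*} [MeasurableSpace α] {μ : Measure α} {f g : α → ℝ}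
    (hf : MemLp f 2 μ) (hg : MemLp g 2 μ) :
    inner ℝ (hf.toLp f) (hg.toLp g) = ∫ x, f x * g x ∂μ := by
  rw [L2.inner_def]
  refine integral_congr_ae ?_
  filter_upwards [hf.coeFn_toLp, hg.coeFn_toLp] with x hx hy
  rw [hx, hy]
  simp [mul_comm]

open Matrix in
lemma eq_zero_of_forall_inner_gaussExpLp {f : Lp ℝ 2 (_root_.stdGaussian n)}
    (h : ∀ s, inner ℝ (gaussExpLp s) f = 0) : f = 0 := by
  have hfm : Measurable f := (Lp.stronglyMeasurable f).measurable
  have hfi : Integrable f (_root_.stdGaussian n) := (Lp.memLp f).integrable one_le_two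
  have hint : ∀ s : Fin n → ℝ,
      Integrable (fun x => f x * Real.exp (s ⬝ᵥ x)) (_root_.stdGaussian n) := fun s => by
    have := ((memLp_gaussExp s).integrable_mul (Lp.memLp f)).const_mul (Real.exp (s ⬝ᵥ s / 2))
    refine this.congr (Filter.Eventually.of_forall fun x => ?_)
    simp only [Pi.mul_apply, gaussExp_eq_mul]
    rw [mul_assoc, ← mul_assoc, ← Real.exp_add, add_neg_cancel, Real.exp_zero, one_mul, mul_comm]
  have hzero : ∀ s : Fin n → ℝ, ∫ x, f x * Real.exp (s ⬝ᵥ x) ∂(_root_.stdGaussian n) = 0 := by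
    intro s
    have h₁ := inner_toLp_toLp (memLp_gaussExp s) (Lp.memLp f)
    rw [Lp.toLp_coeFn] at h₁
    have h₂ := h₁.symm.trans (h s)
    simp only [gaussExp_eq_mul, mul_assoc] at h₂
    rw [integral_const_mul] at h₂
    simpa [(Real.exp_pos _).ne', mul_comm] using h₂
  have hpos : ∀ g : (Fin n → ℝ) → ℝ, ∀ s : Fin n → ℝ,
      Integrable (fun x => g x * Real.exp (s ⬝ᵥ x)) (_root_.stdGaussian n) →
      Integrable (fun x => max (g x) 0 * Real.exp (s ⬝ᵥ x)) (_root_.stdGaussian n) := by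
    intro g s hgs
    refine hgs.pos_part.congr (Filter.Eventually.of_forall fun x => ?_)
    simp only
    rw [max_mul_of_nonneg _ _ (Real.exp_pos _).le, zero_mul]
  have hfneg : ∀ s : Fin n → ℝ,
      Integrable (fun x => -f x * Real.exp (s ⬝ᵥ x)) (_root_.stdGaussian n) := fun s =>
    (hint s).neg.congr (Filter.Eventually.of_forall fun x => by simp)
  have hfin₁ : IsFiniteMeasure ((_root_.stdGaussian n).withDensity fun x => ENNReal.ofReal (f x)) :=
    isFiniteMeasure_withDensity_ofReal hfi.2
  have hfin₂ :
      IsFiniteMeasure ((_root_.stdGaussian n).withDensity fun x => ENNReal.ofReal (-f x)) :=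
    isFiniteMeasure_withDensity_ofReal hfi.neg.2
  have heq : (_root_.stdGaussian n).withDensity (fun x => ENNReal.ofReal (f x)) =
      (_root_.stdGaussian n).withDensity fun x => ENNReal.ofReal (-f x) := by
    refine measure_ext_of_integral_exp_dotProduct (fun s => ?_) fun s => ?_
    · rw [integrable_withDensity_iff_integrable_smul₀' (by fun_prop) (by simp)]
      simpa only [ENNReal.toReal_ofReal', smul_eq_mul] using hpos f s (hint s)
    · rw [integral_withDensity_eq_integral_toReal_smul₀ (by fun_prop) (by simp),
        integral_withDensity_eq_integral_toReal_smul₀ (by fun_prop) (by simp)]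
      simp only [ENNReal.toReal_ofReal', smul_eq_mul]
      rw [← sub_eq_zero, ← integral_sub (hpos f s (hint s)) (hpos (fun x => -f x) s (hfneg s))]
      refine (integral_congr_ae (Filter.Eventually.of_forall fun x => ?_)).trans (hzero s)
      simp only [← sub_mul]
      rw [max_zero_sub_max_neg_zero_eq_self]
  have hae := (withDensity_eq_iff (by fun_prop) (by fun_prop) hfi.lintegral_lt_top.ne).1 heq
  refine (Lp.eq_zero_iff_ae_eq_zero).2 ?_
  filter_upwards [hae] with x hx
  rcases le_total (f x) 0 with h0 | h0
  · rw [ENNReal.ofReal_of_nonpos h0] at hx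
    exact le_antisymm h0 (by simpa using ENNReal.ofReal_eq_zero.1 hx.symm)
  · rw [ENNReal.ofReal_of_nonpos (neg_nonpos.2 h0)] at hx
    exact le_antisymm (ENNReal.ofReal_eq_zero.1 hx) h0

lemma topologicalClosure_span_gaussExpLp :
    (Submodule.span ℝ (Set.range (gaussExpLp (n := n)))).topologicalClosure = ⊤ := by
  rw [Submodule.topologicalClosure_eq_top_iff, Submodule.eq_bot_iff]
  intro f hf
  exact eq_zero_of_forall_inner_gaussExpLp fun s =>
    (Submodule.mem_orthogonal _ f).1 hf _ (Submodule.subset_span ⟨s, rfl⟩)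

/-- The bilinear form `⟨U_ρ f, g⟩` on `L²`. -/
noncomputable def ouForm {ρ : ℝ} (hρ : ρ ^ 2 ≤ 1) (f g : Lp ℝ 2 (_root_.stdGaussian n)) : ℝ :=
  inner ℝ (Lp.compMeasurePreservingₗᵢ ℝ (ouMap n ρ) (measurePreserving_ouMap hρ) f)
    (Lp.compMeasurePreservingₗᵢ ℝ Prod.fst
      (measurePreserving_fst (μ := _root_.stdGaussian n) (ν := _root_.stdGaussian n)) g)

lemma ouForm_toLp {ρ : ℝ} (hρ : ρ ^ 2 ≤ 1) {f g : (Fin n → ℝ) → ℝ}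
    (hf : MemLp f 2 (_root_.stdGaussian n)) (hg : MemLp g 2 (_root_.stdGaussian n)) :
    ouForm hρ (hf.toLp f) (hg.toLp g) =
      ∫ z, f (ouMap n ρ z) * g z.1 ∂((_root_.stdGaussian n).prod (_root_.stdGaussian n)) := by
  rw [ouForm]
  exact inner_toLp_toLp (hf.comp_measurePreserving (measurePreserving_ouMap hρ))
    (hg.comp_measurePreserving measurePreserving_fst)

lemma abs_ouForm_le {ρ : ℝ} (hρ : ρ ^ 2 ≤ 1) (f g : Lp ℝ 2 (_root_.stdGaussian n)) :
    |ouForm hρ f g| ≤ ‖f‖ * ‖g‖ := by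
  refine (abs_real_inner_le_norm _ _).trans_eq ?_
  rw [LinearIsometry.norm_map, LinearIsometry.norm_map]

lemma abs_ouForm_sub_le {ρ : ℝ} (hρ : ρ ^ 2 ≤ 1) (f g f' g' : Lp ℝ 2 (_root_.stdGaussian n)) :
    |ouForm hρ f g - ouForm hρ f' g'| ≤ ‖f - f'‖ * ‖g‖ + ‖f'‖ * ‖g - g'‖ := by
  have : ouForm hρ f g - ouForm hρ f' g' = ouForm hρ (f - f') g + ouForm hρ f' (g - g') := by
    simp only [ouForm, map_sub, inner_sub_left, inner_sub_right]; ring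
  rw [this]
  exact (abs_add_le _ _).trans (add_le_add (abs_ouForm_le _ _ _) (abs_ouForm_le _ _ _))

open Matrix in
lemma ouForm_gaussExpLp {ρ : ℝ} (hρ : ρ ^ 2 ≤ 1) (s t : Fin n → ℝ) :
    ouForm hρ (gaussExpLp s) (gaussExpLp t) = Real.exp (ρ * (s ⬝ᵥ t)) := by
  rw [gaussExpLp, gaussExpLp, ouForm_toLp]
  have hfac : ∀ z : (Fin n → ℝ) × (Fin n → ℝ), gaussExp s (ouMap n ρ z) * gaussExp t z.1 =
      (Real.exp (-(s ⬝ᵥ s / 2) - t ⬝ᵥ t / 2) * Real.exp ((ρ • s + t) ⬝ᵥ z.1)) *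
        Real.exp ((Real.sqrt (1 - ρ ^ 2) • s) ⬝ᵥ z.2) := fun z => by
    rw [gaussExp_eq_mul, gaussExp_eq_mul, exp_dotProduct_ouMap, add_dotProduct, Real.exp_add,
      sub_eq_add_neg (-(s ⬝ᵥ s / 2)), Real.exp_add]
    ring
  simp only [hfac]
  rw [integral_prod_mul (fun x => Real.exp (-(s ⬝ᵥ s / 2) - t ⬝ᵥ t / 2) *
      Real.exp ((ρ • s + t) ⬝ᵥ x)) (fun y => Real.exp ((Real.sqrt (1 - ρ ^ 2) • s) ⬝ᵥ y)),
    integral_const_mul, integral_exp_dotProduct, integral_exp_dotProduct, ← Real.exp_add,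
    ← Real.exp_add]
  congr 1
  simp only [add_dotProduct, dotProduct_add, smul_dotProduct, dotProduct_smul, smul_eq_mul,
    dotProduct_comm t s]
  have := Real.mul_self_sqrt (by linarith : 0 ≤ 1 - ρ ^ 2)
  linear_combination (s ⬝ᵥ s / 2) * this

open Matrix in
lemma dotProduct_pow_div_factorial (s t : Fin n → ℝ) (m : ℕ) :
    (s ⬝ᵥ t) ^ m / m.factorial = ∑ α ∈ Finset.piAntidiag Finset.univ m,
      (∏ i, s i ^ α i / √((α i).factorial : ℝ)) * ∏ i, t i ^ α i / √((α i).factorial : ℝ) := by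
  rw [dotProduct, Finset.sum_pow_eq_sum_piAntidiag, Finset.sum_div]
  refine Finset.sum_congr rfl fun α hα => ?_
  have hsum : ∑ i, α i = m := (Finset.mem_piAntidiag.1 hα).1
  have hspec : (∏ i, ((α i).factorial : ℝ)) * Nat.multinomial Finset.univ α = m.factorial := by
    rw [← hsum]
    exact_mod_cast Nat.multinomial_spec Finset.univ α
  have hprod : ∏ i, ((α i).factorial : ℝ) ≠ 0 :=
    Finset.prod_ne_zero_iff.2 fun i _ => by positivity
  have hmul : ∀ i, s i ^ α i / √((α i).factorial : ℝ) * (t i ^ α i / √((α i).factorial : ℝ)) =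
      (s i * t i) ^ α i / ((α i).factorial : ℝ) := fun i => by
    rw [div_mul_div_comm, Real.mul_self_sqrt (Nat.cast_nonneg _), mul_pow]
  rw [← Finset.prod_mul_distrib, Finset.prod_congr rfl fun i _ => hmul i, Finset.prod_div_distrib,
    ← hspec, mul_comm, mul_div_mul_right]
  have := (Nat.multinomial_pos Finset.univ α).ne'
  exact_mod_cast this

/-- The finite linear combination of the functions `gaussExp s` with coefficients `c`. -/
noncomputable def expComb (c : (Fin n → ℝ) →₀ ℝ) : Lp ℝ 2 (_root_.stdGaussian n) :=
  c.sum fun s a => a • gaussExpLp s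

/-- The Hermite coefficient of index `α` of `expComb c`. -/
noncomputable def expCoeff (c : (Fin n → ℝ) →₀ ℝ) (α : Fin n → ℕ) : ℝ :=
  c.sum fun s a => a * ∏ i, s i ^ α i / √((α i).factorial : ℝ)

/-- The degree-`m` part of the inner product of `expComb c` and `expComb d`. -/
noncomputable def levelForm (m : ℕ) (c d : (Fin n → ℝ) →₀ ℝ) : ℝ :=
  ∑ α ∈ Finset.piAntidiag Finset.univ m, expCoeff c α * expCoeff d α

open Matrix in
lemma levelForm_eq_sum (m : ℕ) (c d : (Fin n → ℝ) →₀ ℝ) :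
    levelForm m c d = ∑ s ∈ c.support, ∑ t ∈ d.support,
      c s * d t * ((s ⬝ᵥ t) ^ m / m.factorial) := by
  simp only [levelForm, expCoeff, Finsupp.sum, Finset.sum_mul_sum]
  simp only [dotProduct_pow_div_factorial, Finset.mul_sum]
  rw [Finset.sum_comm]
  refine Finset.sum_congr rfl fun s _ => ?_
  rw [Finset.sum_comm]
  refine Finset.sum_congr rfl fun t _ => Finset.sum_congr rfl fun α _ => ?_
  ring

open Matrix in
lemma ouForm_expComb {ρ : ℝ} (hρ : ρ ^ 2 ≤ 1) (c d : (Fin n → ℝ) →₀ ℝ) :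
    ouForm hρ (expComb c) (expComb d) = ∑ s ∈ c.support, ∑ t ∈ d.support,
      c s * d t * Real.exp (ρ * (s ⬝ᵥ t)) := by
  simp only [← ouForm_gaussExpLp hρ]
  simp only [ouForm, expComb, Finsupp.sum, map_sum, map_smul, sum_inner, inner_sum,
    real_inner_smul_left, real_inner_smul_right]
  rw [Finset.sum_comm]
  refine Finset.sum_congr rfl fun s _ => Finset.sum_congr rfl fun t _ => ?_
  ring

lemma hasSum_levelForm_even {ρ : ℝ} (hρ : ρ ^ 2 ≤ 1) (hρ' : (-ρ) ^ 2 ≤ 1)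
    (c d : (Fin n → ℝ) →₀ ℝ) :
    HasSum (fun j => levelForm (2 * j) c d * (ρ ^ 2) ^ j)
      ((ouForm hρ (expComb c) (expComb d) + ouForm hρ' (expComb c) (expComb d)) / 2) := by
  have hcosh : (ouForm hρ (expComb c) (expComb d) + ouForm hρ' (expComb c) (expComb d)) / 2 =
      ∑ s ∈ c.support, ∑ t ∈ d.support, c s * d t * Real.cosh (ρ * dotProduct s t) := by
    rw [ouForm_expComb, ouForm_expComb]
    simp only [← Finset.sum_add_distrib, Finset.sum_div, Real.cosh_eq]
    refine Finset.sum_congr rfl fun s _ => Finset.sum_congr rfl fun t _ => ?_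
    rw [neg_mul]
    ring
  rw [hcosh]
  simp only [levelForm_eq_sum, Finset.sum_mul]
  refine hasSum_sum fun s _ => hasSum_sum fun t _ => ?_
  refine ((Real.hasSum_cosh (ρ * dotProduct s t)).mul_left (c s * d t)).congr_fun ?_
  intro j
  rw [mul_pow, ← pow_mul]
  ring

lemma abs_levelForm_le (m : ℕ) (c d : (Fin n → ℝ) →₀ ℝ) :
    |levelForm m c d| ≤ (levelForm m c c + levelForm m d d) / 2 := by
  simp only [levelForm, ← Finset.sum_add_distrib, Finset.sum_div]
  refine (Finset.abs_sum_le_sum_abs _ _).trans (Finset.sum_le_sum fun α _ => ?_)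
  rw [abs_le]
  constructor <;> nlinarith [sq_nonneg (expCoeff c α + expCoeff d α),
    sq_nonneg (expCoeff c α - expCoeff d α)]

lemma summable_levelForm_even (c : (Fin n → ℝ) →₀ ℝ) :
    Summable (fun j => levelForm (2 * j) c c) ∧
      ∑' j, levelForm (2 * j) c c ≤ ‖expComb c‖ ^ 2 := by
  have h := hasSum_levelForm_even (ρ := 1) (by norm_num) (by norm_num) c c
  simp only [one_pow, mul_one] at h
  refine ⟨h.summable, h.tsum_eq.trans_le ?_⟩
  have h₁ := le_of_abs_le (abs_ouForm_le (ρ := 1) (by norm_num) (expComb c) (expComb c))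
  have h₂ := le_of_abs_le (abs_ouForm_le (ρ := -1) (by norm_num) (expComb c) (expComb c))
  linarith [pow_two ‖expComb c‖]

lemma summable_abs_levelForm_even (c d : (Fin n → ℝ) →₀ ℝ) :
    Summable (fun j => |levelForm (2 * j) c d|) ∧
      ∑' j, |levelForm (2 * j) c d| ≤ (‖expComb c‖ ^ 2 + ‖expComb d‖ ^ 2) / 2 := by
  obtain ⟨hc, hc'⟩ := summable_levelForm_even c
  obtain ⟨hd, hd'⟩ := summable_levelForm_even d
  have hsum := (hc.add hd).div_const 2
  have hs : Summable (fun j => |levelForm (2 * j) c d|) :=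
    hsum.of_nonneg_of_le (fun _ => abs_nonneg _) fun j => abs_levelForm_le _ c d
  refine ⟨hs, (hs.tsum_le_tsum (fun j => abs_levelForm_le _ c d) hsum).trans ?_⟩
  rw [tsum_div_const, hc.tsum_add hd]
  linarith

/-- If the even part of `ρ ↦ ⟨U_ρ f, g⟩` is nearly constant, then its degree-two part is small. -/
lemma abs_levelForm_two_le {c d : (Fin n → ℝ) →₀ ℝ} {M p₀ : ℝ}
    (h : ∀ (ρ : ℝ) (hρ : ρ ^ 2 ≤ 1) (hρ' : (-ρ) ^ 2 ≤ 1), 0 ≤ ρ →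
      |(ouForm hρ (expComb c) (expComb d) + ouForm hρ' (expComb c) (expComb d)) / 2 - p₀| ≤ M)
    {k : ℕ} (hk : 1 ≤ k) :
    |levelForm 2 c d| ≤
      4 * k ^ 2 * (M + ((‖expComb c‖ ^ 2 + ‖expComb d‖ ^ 2) / 2 + 1) * (1 / 2) ^ k) := by
  obtain ⟨hs, hs'⟩ := summable_abs_levelForm_even c d
  refine abs_coeff_one_le_of_forall_abs_tsum_sub_le (b := fun j => levelForm (2 * j) c d)
    (p₀ := p₀) (by positivity) hs (by linarith) (fun t ht => ?_) hk
  have hsq : √t ^ 2 = t := Real.sq_sqrt ht.1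
  have hρ : √t ^ 2 ≤ 1 := by rw [hsq]; linarith [ht.2]
  have hρ' : (-√t) ^ 2 ≤ 1 := by rwa [neg_sq]
  have := (hasSum_levelForm_even hρ hρ' c d).tsum_eq
  rw [hsq] at this
  rw [this]
  exact h _ hρ hρ' (Real.sqrt_nonneg _)

lemma integral_exp_mul_gaussianReal (t : ℝ) :
    ∫ x, Real.exp (t * x) ∂(gaussianReal 0 1) = Real.exp (t ^ 2 / 2) := by
  simpa [mgf] using congrFun (mgf_fun_id_gaussianReal (μ := 0) (v := 1)) t

lemma integrable_pow_mul_exp_gaussianReal (t : ℝ) (k : ℕ) :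
    Integrable (fun x => x ^ k * Real.exp (t * x)) (gaussianReal 0 1) :=
  integrable_pow_mul_exp_of_mem_interior_integrableExpSet (X := fun x : ℝ => x) (by simp) k

lemma hasDerivAt_integral_pow_mul_exp_gaussianReal (t : ℝ) (k : ℕ) :
    HasDerivAt (fun t => ∫ x, x ^ k * Real.exp (t * x) ∂(gaussianReal 0 1))
      (∫ x, x ^ (k + 1) * Real.exp (t * x) ∂(gaussianReal 0 1)) t :=
  hasDerivAt_integral_pow_mul_exp_real (X := fun x : ℝ => x) (by simp) k

lemma hasDerivAt_exp_sq_div_two (t : ℝ) :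
    HasDerivAt (fun t : ℝ => Real.exp (t ^ 2 / 2)) (t * Real.exp (t ^ 2 / 2)) t := by
  have := ((hasDerivAt_pow 2 t).div_const 2).exp
  refine this.congr_deriv ?_
  norm_num
  ring

lemma integral_id_mul_exp_gaussianReal (t : ℝ) :
    ∫ x, x * Real.exp (t * x) ∂(gaussianReal 0 1) = t * Real.exp (t ^ 2 / 2) := by
  have h := hasDerivAt_integral_pow_mul_exp_gaussianReal t 0
  simp only [pow_zero, one_mul, integral_exp_mul_gaussianReal, zero_add, pow_one] at h
  exact h.unique (hasDerivAt_exp_sq_div_two t)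

lemma integral_sq_mul_exp_gaussianReal (t : ℝ) :
    ∫ x, x ^ 2 * Real.exp (t * x) ∂(gaussianReal 0 1) = (t ^ 2 + 1) * Real.exp (t ^ 2 / 2) := by
  have h := hasDerivAt_integral_pow_mul_exp_gaussianReal t 1
  simp only [pow_one, integral_id_mul_exp_gaussianReal, Nat.reduceAdd] at h
  rw [h.unique ((hasDerivAt_id' t).mul (hasDerivAt_exp_sq_div_two t))]
  ring

lemma hermiteFn_zero (x : ℝ) : hermiteFn 0 x = 1 := by simp [hermiteFn]

lemma hermiteFn_one (x : ℝ) : hermiteFn 1 x = x := by simp [hermiteFn]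

lemma hermiteFn_two (x : ℝ) : hermiteFn 2 x = (x ^ 2 - 1) / √2 := by
  simp [hermiteFn, Polynomial.hermite_succ, sq]

lemma integral_exp_mul_hermiteFn {k : ℕ} (hk : k ≤ 2) (t : ℝ) :
    ∫ x, Real.exp (t * x) * hermiteFn k x ∂(gaussianReal 0 1) =
      Real.exp (t ^ 2 / 2) * (t ^ k / √(k.factorial : ℝ)) := by
  have h₂ := integrable_pow_mul_exp_gaussianReal t 2
  have h₀ := integrable_pow_mul_exp_gaussianReal t 0
  simp only [pow_zero, one_mul] at h₀
  interval_cases k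
  · simp [hermiteFn_zero, integral_exp_mul_gaussianReal]
  · simp only [hermiteFn_one, mul_comm (Real.exp _), integral_id_mul_exp_gaussianReal]
    simp
  · have : ∀ x : ℝ, Real.exp (t * x) * hermiteFn 2 x =
        (x ^ 2 * Real.exp (t * x) - Real.exp (t * x)) / √2 := fun x => by
      rw [hermiteFn_two]; ring
    simp only [this]
    rw [integral_div, integral_sub h₂ h₀, integral_sq_mul_exp_gaussianReal,
      integral_exp_mul_gaussianReal]
    simp only [Nat.factorial_two, Nat.cast_ofNat]
    ring

lemma continuous_hermiteFn (k : ℕ) : Continuous (hermiteFn k) :=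
  (Polynomial.continuous _).div_const _

lemma integrable_eval_gaussianReal (p : Polynomial ℝ) :
    Integrable (fun x => p.eval x) (gaussianReal 0 1) := by
  simp only [Polynomial.eval_eq_sum_range]
  refine integrable_finsetSum _ fun k _ => Integrable.const_mul ?_ _
  simpa using integrable_pow_mul_exp_gaussianReal 0 k

lemma integrable_hermiteFn_sq (k : ℕ) :
    Integrable (fun x => hermiteFn k x ^ 2) (gaussianReal 0 1) := by
  simp only [hermiteFn, div_pow, ← Polynomial.eval_pow]
  exact (integrable_eval_gaussianReal _).div_const _

lemma memLp_prod_hermiteFn (α : Fin n → ℕ) :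
    MemLp (fun x : Fin n → ℝ => ∏ i, hermiteFn (α i) (x i)) 2 (_root_.stdGaussian n) := by
  have hc : Continuous fun x : Fin n → ℝ => ∏ i, hermiteFn (α i) (x i) :=
    continuous_finsetProd _ fun i _ => (continuous_hermiteFn _).comp (continuous_apply i)
  rw [memLp_two_iff_integrable_sq hc.aestronglyMeasurable]
  simp only [← Finset.prod_pow]
  exact Integrable.fintype_prod (f := fun i y => hermiteFn (α i) y ^ 2)
    fun i => integrable_hermiteFn_sq _

/-- The multivariate normalized Hermite polynomial of index `α` as an element of `L²`. -/
noncomputable def hermiteLp (α : Fin n → ℕ) : Lp ℝ 2 (_root_.stdGaussian n) :=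
  (memLp_prod_hermiteFn α).toLp _

lemma inner_gaussExpLp_hermiteLp {α : Fin n → ℕ} (hα : ∀ i, α i ≤ 2) (s : Fin n → ℝ) :
    inner ℝ (gaussExpLp s) (hermiteLp α) = ∏ i, s i ^ α i / √((α i).factorial : ℝ) := by
  rw [gaussExpLp, hermiteLp, inner_toLp_toLp]
  simp only [gaussExp_eq_mul, exp_dotProduct_eq_prod, mul_assoc, ← Finset.prod_mul_distrib]
  rw [integral_const_mul, _root_.stdGaussian,
    integral_fintype_prod_eq_prod (fun i y => Real.exp (s i * y) * hermiteFn (α i) y),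
    Finset.prod_congr rfl fun i _ => integral_exp_mul_hermiteFn (hα i) (s i),
    Finset.prod_mul_distrib, ← Real.exp_sum, ← Finset.sum_div, ← mul_assoc, ← Real.exp_add,
    dotProduct]
  simp [sq]

lemma inner_expComb_hermiteLp {α : Fin n → ℕ} (hα : ∀ i, α i ≤ 2) (c : (Fin n → ℝ) →₀ ℝ) :
    inner ℝ (expComb c) (hermiteLp α) = expCoeff c α := by
  simp only [expComb, expCoeff, Finsupp.sum, sum_inner, real_inner_smul_left,
    inner_gaussExpLp_hermiteLp hα]

lemma filter_piFinset_range_three :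
    (Fintype.piFinset fun _ : Fin n => Finset.range 3).filter (fun α => ∑ i, α i = 2) =
      Finset.piAntidiag Finset.univ 2 := by
  ext α
  simp only [Finset.mem_filter, Fintype.mem_piFinset, Finset.mem_range, Finset.mem_piAntidiag,
    Finset.mem_univ, implies_true, and_true, and_iff_right_iff_imp]
  intro h i
  have := Finset.single_le_sum (fun j _ => Nat.zero_le (α j)) (Finset.mem_univ i)
  omega

/-- Stability of `abs_levelForm_two_le` under `L²` limits. -/
lemma abs_sum_inner_hermiteLp_le {f g : Lp ℝ 2 (_root_.stdGaussian n)} {M p₀ : ℝ}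
    (h : ∀ (ρ : ℝ) (hρ : ρ ^ 2 ≤ 1) (hρ' : (-ρ) ^ 2 ≤ 1), 0 ≤ ρ →
      |(ouForm hρ f g + ouForm hρ' f g) / 2 - p₀| ≤ M) {k : ℕ} (hk : 1 ≤ k) :
    |∑ α ∈ Finset.piAntidiag Finset.univ 2,
        inner ℝ f (hermiteLp α) * inner ℝ g (hermiteLp α)| ≤
      4 * k ^ 2 * (M + ((‖f‖ ^ 2 + ‖g‖ ^ 2) / 2 + 1) * (1 / 2) ^ k) := by
  have hdense : ∀ f : Lp ℝ 2 (_root_.stdGaussian n), ∃ c : ℕ → (Fin n → ℝ) →₀ ℝ,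
      Filter.Tendsto (fun N => expComb (c N)) Filter.atTop (nhds f) := by
    intro f
    have hf : f ∈ closure (Submodule.span ℝ (Set.range (gaussExpLp (n := n))) :
        Set (Lp ℝ 2 (_root_.stdGaussian n))) := by
      rw [← Submodule.topologicalClosure_coe, topologicalClosure_span_gaussExpLp]
      trivial
    obtain ⟨u, hu, hlim⟩ := mem_closure_iff_seq_limit.1 hf
    choose c hc using fun N => Finsupp.mem_span_range_iff_exists_finsupp.1 (hu N)
    exact ⟨c, by simpa only [expComb, hc] using hlim⟩
  obtain ⟨c, hc⟩ := hdense f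
  obtain ⟨d, hd⟩ := hdense g
  set e : ℕ → ℝ := fun N => ‖expComb (c N) - f‖ * ‖expComb (d N)‖ + ‖f‖ * ‖expComb (d N) - g‖
    with he
  have hsub : ∀ (u : ℕ → Lp ℝ 2 (_root_.stdGaussian n)) (v : Lp ℝ 2 (_root_.stdGaussian n)),
      Filter.Tendsto u Filter.atTop (nhds v) →
      Filter.Tendsto (fun N => ‖u N - v‖) Filter.atTop (nhds 0) := fun u v huv =>
    tendsto_iff_norm_sub_tendsto_zero.1 huv
  have helim : Filter.Tendsto e Filter.atTop (nhds 0) := by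
    simpa using ((hsub _ _ hc).mul hd.norm).add ((hsub _ _ hd).const_mul ‖f‖)
  have hbound : ∀ N, |levelForm 2 (c N) (d N)| ≤ 4 * k ^ 2 *
      (M + e N + ((‖expComb (c N)‖ ^ 2 + ‖expComb (d N)‖ ^ 2) / 2 + 1) * (1 / 2) ^ k) := by
    intro N
    refine abs_levelForm_two_le (p₀ := p₀) (fun ρ hρ hρ' h0 => ?_) hk
    have h₀ := abs_le.1 (h ρ hρ hρ' h0)
    have h₁ := abs_le.1 (abs_ouForm_sub_le hρ (expComb (c N)) (expComb (d N)) f g)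
    have h₂ := abs_le.1 (abs_ouForm_sub_le hρ' (expComb (c N)) (expComb (d N)) f g)
    rw [abs_le]
    constructor <;> simp only [he] <;> linarith [h₀.1, h₀.2, h₁.1, h₁.2, h₂.1, h₂.2]
  refine le_of_tendsto_of_tendsto' (b := Filter.atTop) (f := fun N => |levelForm 2 (c N) (d N)|) ?_ ?_ hbound
  · refine Filter.Tendsto.abs (tendsto_finsetSum _ fun α hα => ?_)
    have hα' : ∀ i, α i ≤ 2 := by
      rw [← filter_piFinset_range_three, Finset.mem_filter, Fintype.mem_piFinset] at hα
      exact fun i => Nat.lt_succ_iff.1 (Finset.mem_range.1 (hα.1 i))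
    simp only [← inner_expComb_hermiteLp hα']
    exact (hc.inner tendsto_const_nhds).mul (hd.inner tendsto_const_nhds)
  · have := ((helim.const_add M).add (((((hc.norm.pow 2).add (hd.norm.pow 2)).div_const 2).add_const
      1).mul_const ((1 / 2 : ℝ) ^ k))).const_mul (4 * (k : ℝ) ^ 2)
    rwa [add_zero] at this

lemma memLp_indicator_of_convex {K : Set (Fin n → ℝ)} (hK : Convex ℝ K) :
    MemLp (K.indicator fun _ => (1 : ℝ)) 2 (_root_.stdGaussian n) := by
  have hnull : NullMeasurableSet K (_root_.stdGaussian n) :=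
    (hK.nullMeasurableSet (μ := volume)).mono_ac stdGaussian_absolutelyContinuous
  refine MemLp.of_bound (aestronglyMeasurable_const.indicator₀ hnull) 1
    (Filter.Eventually.of_forall fun x => ?_)
  exact (norm_indicator_le_norm_self _ _).trans (by simp)

lemma norm_toLp_indicator_sq_le {K : Set (Fin n → ℝ)}
    (hK : MemLp (K.indicator fun _ => (1 : ℝ)) 2 (_root_.stdGaussian n)) :
    ‖hK.toLp _‖ ^ 2 ≤ 1 := by
  rw [← real_inner_self_eq_norm_sq, inner_toLp_toLp]
  refine (integral_mono (hK.integrable_mul hK) (integrable_const (1 : ℝ)) fun x => ?_).trans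
    (by simp)
  by_cases hx : x ∈ K <;> simp [hx]

lemma ouForm_toLp_eq_integral_ouOp {ρ : ℝ} (hρ : ρ ^ 2 ≤ 1) {f g : (Fin n → ℝ) → ℝ}
    (hf : MemLp f 2 (_root_.stdGaussian n)) (hg : MemLp g 2 (_root_.stdGaussian n)) :
    ouForm hρ (hf.toLp f) (hg.toLp g) = ∫ x, ouOp n ρ f x * g x ∂(_root_.stdGaussian n) := by
  have hint : Integrable (fun z : (Fin n → ℝ) × (Fin n → ℝ) => f (ouMap n ρ z) * g z.1)
      ((_root_.stdGaussian n).prod (_root_.stdGaussian n)) :=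
    (hf.comp_measurePreserving (measurePreserving_ouMap hρ)).integrable_mul
      (hg.comp_measurePreserving measurePreserving_fst)
  rw [ouForm_toLp, integral_prod _ hint]
  simp only [integral_mul_const]
  rfl

lemma ouOp_neg {f : (Fin n → ℝ) → ℝ} (hf : ∀ x, f (-x) = f x) (ρ : ℝ) (x : Fin n → ℝ) :
    ouOp n (-ρ) f x = ouOp n ρ f x := by
  rw [ouOp, ouOp, ← (measurePreserving_neg_stdGaussian (n := n)).integral_comp
    (MeasurableEquiv.neg (Fin n → ℝ)).measurableEmbedding]
  refine integral_congr_ae (Filter.Eventually.of_forall fun y => ?_)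
  simp only
  rw [← hf, neg_sq]
  congr 1
  simp [add_comm]

lemma ouOp_one (f : (Fin n → ℝ) → ℝ) (x : Fin n → ℝ) : ouOp n 1 f x = f x := by
  simp [ouOp]

lemma ouOp_zero (f : (Fin n → ℝ) → ℝ) (x : Fin n → ℝ) :
    ouOp n 0 f x = ∫ y, f y ∂(_root_.stdGaussian n) := by
  simp [ouOp]

lemma indicator_neg_of_symmetric {K : Set (Fin n → ℝ)} (hK : ∀ x ∈ K, -x ∈ K)
    (x : Fin n → ℝ) : K.indicator (fun _ => (1 : ℝ)) (-x) = K.indicator (fun _ => (1 : ℝ)) x := by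
  have : -x ∈ K ↔ x ∈ K := ⟨fun h => by simpa using hK _ h, hK x⟩
  by_cases hx : x ∈ K <;> simp [hx, this]

end GaussianSpace

/-- Quantitative Gaussian Correlation Inequality: for centrally symmetric convex sets
`K, L ⊆ ℝ^n` (assuming Royen's GCI in the form that `ρ ↦ ⟨U_ρ K, L⟩` is nondecreasing),
`E[KL] - E[K]E[L] ≥ (1/C)·Φ(∑_{|α|=2} K̃(α)L̃(α))` for a universal constant `C > 0`. -/
theorem stmt12 :
    ∃ C : ℝ, 0 < C ∧ ∀ (n : ℕ) (K L : Set (Fin n → ℝ)),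
      Convex ℝ K → Convex ℝ L → (∀ x ∈ K, -x ∈ K) → (∀ x ∈ L, -x ∈ L) →
      MonotoneOn (fun ρ => ∫ x, ouOp n ρ (K.indicator fun _ => (1:ℝ)) x *
          L.indicator (fun _ => (1:ℝ)) x ∂(stdGaussian n)) (Set.Icc (0:ℝ) 1) →
      (1 / C) * Phi (∑ α ∈ (Fintype.piFinset fun _ : Fin n => Finset.range 3).filter
            (fun α => ∑ i, α i = 2),
          (∫ x, K.indicator (fun _ => (1:ℝ)) x * ∏ i, hermiteFn (α i) (x i) ∂(stdGaussian n)) *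
          (∫ x, L.indicator (fun _ => (1:ℝ)) x * ∏ i, hermiteFn (α i) (x i) ∂(stdGaussian n)))
        ≤ (∫ x, K.indicator (fun _ => (1:ℝ)) x * L.indicator (fun _ => (1:ℝ)) x ∂(stdGaussian n))
          - (∫ x, K.indicator (fun _ => (1:ℝ)) x ∂(stdGaussian n)) *
            (∫ x, L.indicator (fun _ => (1:ℝ)) x ∂(stdGaussian n)) := by
  refine ⟨12800, by norm_num, fun n K L hK hL hKs hLs hmono => ?_⟩
  have hKm := memLp_indicator_of_convex hK
  have hLm := memLp_indicator_of_convex hL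
  set f : (Fin n → ℝ) → ℝ := K.indicator fun _ => (1 : ℝ) with hf
  set g : (Fin n → ℝ) → ℝ := L.indicator fun _ => (1 : ℝ) with hg
  set p : ℝ → ℝ := fun ρ => ∫ x, ouOp n ρ f x * g x ∂(_root_.stdGaussian n) with hp
  have hp1 : p 1 = ∫ x, f x * g x ∂(_root_.stdGaussian n) := by simp only [hp, ouOp_one]
  have hp0 : p 0 = (∫ x, f x ∂(_root_.stdGaussian n)) * ∫ x, g x ∂(_root_.stdGaussian n) := by
    simp only [hp, ouOp_zero, integral_const_mul]
  have hle : ∀ ρ ∈ Set.Icc (0 : ℝ) 1, p 0 ≤ p ρ ∧ p ρ ≤ p 1 := fun ρ hρ =>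
    ⟨hmono ⟨le_rfl, zero_le_one⟩ hρ hρ.1, hmono hρ ⟨zero_le_one, le_rfl⟩ hρ.2⟩
  have hδ : 0 ≤ p 1 - p 0 := sub_nonneg.2 (hle 1 ⟨zero_le_one, le_rfl⟩).1
  have hform : ∀ (ρ : ℝ) (hρ : ρ ^ 2 ≤ 1) (hρ' : (-ρ) ^ 2 ≤ 1), 0 ≤ ρ →
      |(ouForm hρ (hKm.toLp f) (hLm.toLp g) + ouForm hρ' (hKm.toLp f) (hLm.toLp g)) / 2 - p 0| ≤
        p 1 - p 0 := by
    intro ρ hρ hρ' h0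
    have hρ1 : ρ ≤ 1 := by nlinarith
    rw [ouForm_toLp_eq_integral_ouOp, ouForm_toLp_eq_integral_ouOp]
    have hneg : ∀ x, ouOp n (-ρ) f x = ouOp n ρ f x := ouOp_neg (indicator_neg_of_symmetric hKs) ρ
    simp only [hneg]
    have h := hle ρ ⟨h0, hρ1⟩
    change |(p ρ + p ρ) / 2 - p 0| ≤ _
    rw [abs_le]
    constructor <;> linarith [h.1, h.2]
  rw [← hp1, ← hp0, filter_piFinset_range_three, one_div_mul_eq_div, div_le_iff₀' (by norm_num)]
  refine Phi_le_of_forall_le hδ fun k hk => ?_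
  have hmain := (le_abs_self _).trans (abs_sum_inner_hermiteLp_le hform hk)
  simp only [hermiteLp, inner_toLp_toLp] at hmain
  refine hmain.trans ?_
  have h₁ := norm_toLp_indicator_sq_le hKm
  have h₂ := norm_toLp_indicator_sq_le hLm
  gcongr
  linarith
end
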